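/- Let k be an even positive integer, let G be a multigraph with all degrees even, and let f : V(G) → Z_2 with ∑_{v∈V(G)} f(v) ≡ 0 (mod 2). If d_G(X) ≥ 3k−2 for every vertex set X with ∑_{v∈X} f(v) odd, then G can be edge-decomposed into k spanning subgraphs G_1, …, G_k such that for each vertex v and each i, d_{G_i}(v) ≡ f(v) (mod 2) and |d_{G_i}(v) − d_G(v)/k| < 2. -/

import Mathlib

open Finset

variable {V E : Type*}

/-- Degree of `v` in the sub-multigraph given by the edge set `S`,
where `ends e` gives the two endpoints of edge `e` (loops count twice). -/
def mdeg [DecidableEq V] (ends : E → V × V) (S : Finset E) (v : V) : ℕ :=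
  (S.filter fun e => (ends e).1 = v).card + (S.filter fun e => (ends e).2 = v).card

/-- Number of edges with exactly one end in the vertex set `X`. -/
def cutCard [Fintype E] [DecidableEq V] (ends : E → V × V) (X : Finset V) : ℕ :=
  (univ.filter fun e : E =>
    ((ends e).1 ∈ X ∧ (ends e).2 ∉ X) ∨ ((ends e).1 ∉ X ∧ (ends e).2 ∈ X)).card

/-- `lam`-edge-connectedness: every edge cut has at least `lam` edges. -/
def EdgeConn [Fintype V] [Fintype E] [DecidableEq V] (ends : E → V × V) (lam : ℕ) : Prop :=
  ∀ X : Finset V, X.Nonempty → X ≠ univ → lam ≤ cutCard ends X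


namespace PF

/-! ### Distance to the multiples of `2 * k` -/

/-- Distance from `x` to the nearest multiple of `2 * k`. -/
def tk (k x : ℤ) : ℤ := min (x % (2 * k)) (2 * k - x % (2 * k))

theorem tk_nonneg {k : ℤ} (hk : 0 < k) (x : ℤ) : 0 ≤ tk k x := by
  have h1 := Int.emod_nonneg x (show 2 * k ≠ 0 by omega)
  have h2 := Int.emod_lt_of_pos x (show 0 < 2 * k by omega)
  unfold tk; omega

theorem tk_le_k (k x : ℤ) : tk k x ≤ k := by
  unfold tk; omega

theorem tk_le {k : ℤ} (hk : 0 < k) (x j : ℤ) : tk k x ≤ |x - 2 * k * j| := by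
  have h1 := Int.emod_nonneg x (show 2 * k ≠ 0 by omega)
  have h2 := Int.emod_lt_of_pos x (show 0 < 2 * k by omega)
  have h3 := Int.emod_add_mul_ediv x (2 * k)
  unfold tk
  set m := x % (2 * k)
  set c := x / (2 * k)
  have h4 : x - 2 * k * j = 2 * k * (c - j) + m := by linarith
  rw [h4]
  rcases le_or_gt 0 (c - j) with h | h
  · have : 0 ≤ 2 * k * (c - j) := by positivity
    rw [abs_of_nonneg (by omega)]; omega
  · have : 2 * k * (c - j) ≤ 2 * k * (-1) := by
      apply mul_le_mul_of_nonneg_left <;> omega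
    rw [abs_of_nonpos (by omega)]; omega

theorem tk_exists {k : ℤ} (hk : 0 < k) (x : ℤ) : ∃ j, tk k x = |x - 2 * k * j| := by
  have h1 := Int.emod_nonneg x (show 2 * k ≠ 0 by omega)
  have h2 := Int.emod_lt_of_pos x (show 0 < 2 * k by omega)
  have h3 := Int.emod_add_mul_ediv x (2 * k)
  unfold tk
  rcases le_total (x % (2 * k)) (2 * k - x % (2 * k)) with h | h
  · refine ⟨x / (2 * k), ?_⟩
    rw [min_eq_left h, abs_of_nonneg] <;> linarith
  · refine ⟨x / (2 * k) + 1, ?_⟩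
    rw [min_eq_right h, abs_of_nonpos] <;> linarith

theorem tk_add_abs {k : ℤ} (hk : 0 < k) (x y : ℤ) : tk k (x + y) ≤ tk k x + |y| := by
  obtain ⟨j, hj⟩ := tk_exists hk x
  have h := tk_le hk (x + y) j
  have h2 := abs_add_le (x - 2 * k * j) y
  have : x + y - 2 * k * j = x - 2 * k * j + y := by ring
  rw [this] at h; linarith

theorem tk_add {k : ℤ} (hk : 0 < k) (x y : ℤ) : tk k (x + y) ≤ tk k x + tk k y := by
  obtain ⟨j, hj⟩ := tk_exists hk x
  obtain ⟨l, hl⟩ := tk_exists hk y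
  have h := tk_le hk (x + y) (j + l)
  have h2 := abs_add_le (x - 2 * k * j) (y - 2 * k * l)
  have : x + y - 2 * k * (j + l) = x - 2 * k * j + (y - 2 * k * l) := by ring
  rw [this] at h; linarith

theorem tk_congr {k : ℤ} {x y : ℤ} (h : 2 * k ∣ x - y) : tk k x = tk k y := by
  unfold tk
  have : x % (2 * k) = y % (2 * k) := by
    rw [Int.emod_eq_emod_iff_emod_sub_eq_zero]; exact Int.emod_eq_zero_of_dvd h
  rw [this]

theorem tk_neg {k : ℤ} (hk : 0 < k) (x : ℤ) : tk k (-x) = tk k x := by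
  apply le_antisymm
  · obtain ⟨j, hj⟩ := tk_exists hk x
    have := tk_le hk (-x) (-j)
    rw [show -x - 2 * k * -j = -(x - 2 * k * j) by ring, abs_neg] at this
    linarith
  · obtain ⟨j, hj⟩ := tk_exists hk (-x)
    have := tk_le hk x (-j)
    rw [show x - 2 * k * -j = -(-x - 2 * k * j) by ring, abs_neg] at this
    linarith

theorem two_dvd_abs_sub (x : ℤ) : 2 ∣ |x| - x := by
  rcases abs_choice x with h | h <;> rw [h] <;> omega

theorem tk_par {k : ℤ} (hk : 0 < k) (x : ℤ) : 2 ∣ tk k x - x := by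
  obtain ⟨j, hj⟩ := tk_exists hk x
  have h := two_dvd_abs_sub (x - 2 * k * j)
  have h2 : (2 : ℤ) ∣ 2 * k * j := ⟨k * j, by ring⟩
  omega

theorem tk_eq_zero {k : ℤ} (hk : 0 < k) (x : ℤ) : tk k x = 0 ↔ 2 * k ∣ x := by
  constructor
  · intro h
    obtain ⟨j, hj⟩ := tk_exists hk x
    rw [h] at hj
    have := abs_eq_zero.1 hj.symm
    exact ⟨j, by linarith⟩
  · rintro ⟨j, rfl⟩
    have := tk_le hk (2 * k * j) j
    have h2 := tk_nonneg hk (2 * k * j)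
    simp at this; omega

theorem tk_of_range {k : ℤ} (hk : 0 < k) {x : ℤ} (h0 : 0 ≤ x) (h : x ≤ 2 * k) :
    tk k x = min x (2 * k - x) := by
  rcases h.lt_or_eq with h | rfl
  · unfold tk; rw [Int.emod_eq_of_lt h0 h]
  · rw [(tk_eq_zero hk _).2 dvd_rfl]; omega

theorem tk_step {k : ℤ} (hk : 0 < k) {x : ℤ} (h : tk k x ≠ 0) :
    tk k (x - 1) = tk k x - 1 ∨ tk k (x + 1) = tk k x - 1 := by
  obtain ⟨j, hj⟩ := tk_exists hk x
  have h1 := tk_add_abs hk (x - 1) 1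
  have h2 := tk_add_abs hk (x + 1) (-1)
  have h3 := tk_le hk (x - 1) j
  have h4 := tk_le hk (x + 1) j
  simp at h1 h2
  set y := 2 * k * j
  rcases le_total 0 (x - y) with h0 | h0
  · rw [abs_of_nonneg h0] at hj
    left
    rw [abs_of_nonneg (by omega)] at h3
    omega
  · rw [abs_of_nonpos h0] at hj
    right
    rw [abs_of_nonpos (by omega)] at h4
    omega

theorem tk_pos {k : ℤ} (hk : 0 < k) {x : ℤ} (h : tk k (x - 1) = tk k x - 1) :
    2 * k ∣ x - tk k x := by
  obtain ⟨j, hj⟩ := tk_exists hk x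
  have hle := tk_le_k k x
  have h0 := tk_nonneg hk x
  rcases le_total 0 (x - 2 * k * j) with h1 | h1
  · rw [abs_of_nonneg h1] at hj
    exact ⟨j, by linarith⟩
  · rw [abs_of_nonpos h1] at hj
    rcases hle.lt_or_eq with h2 | h2
    · exfalso
      have h3 : tk k (x - 1) = tk k (tk k x + 1) := by
        rw [← tk_neg hk (tk k x + 1)]
        apply tk_congr
        refine ⟨j, by linarith⟩
      have h4 := tk_of_range hk (x := tk k x + 1) (by omega) (by omega)
      omega
    · exact ⟨j - 1, by linarith⟩



set_option linter.unusedSectionVars false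

/-! ### Cuts and excesses -/

section basics
variable [DecidableEq V] [DecidableEq E]

/-- Integer indicator of membership. -/
def iv (A : Finset V) (v : V) : ℤ := if v ∈ A then 1 else 0

/-- Signed incidence of the edge `x` with the set `A`. -/
def chi (en : E → V × V) (A : Finset V) (x : E) : ℤ := iv A (en x).1 - iv A (en x).2

/-- Number of edges of `S` in the cut of `A`, as an integer. -/
def dd (en : E → V × V) (S : Finset E) (A : Finset V) : ℤ := ∑ x ∈ S, |chi en A x|

/-- Signed excess (out minus in) at `A`. -/
def exc (en : E → V × V) (S : Finset E) (σ : E → ℤ) (A : Finset V) : ℤ := ∑ x ∈ S, σ x * chi en A x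

/-- sign functions -/
def PM (σ : E → ℤ) : Prop := ∀ x, σ x = 1 ∨ σ x = -1

theorem iv_cases (A : Finset V) (v : V) : (v ∈ A ∧ iv A v = 1) ∨ (v ∉ A ∧ iv A v = 0) := by
  unfold iv; by_cases h : v ∈ A <;> simp [h]

theorem iv_sum (A : Finset V) (v : V) : iv A v = ∑ u ∈ A, iv {u} v := by
  unfold iv; simp

theorem iv_single (u v : V) : iv {u} v = if v = u then 1 else 0 := by
  unfold iv; simp

theorem chi_sum (en : E → V × V) (A : Finset V) (x : E) : chi en A x = ∑ v ∈ A, chi en {v} x := by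
  unfold chi; rw [iv_sum A, iv_sum A, Finset.sum_sub_distrib]

theorem chi_cases (en : E → V × V) (A : Finset V) (x : E) :
    chi en A x = 0 ∨ chi en A x = 1 ∨ chi en A x = -1 := by
  unfold chi
  rcases iv_cases A (en x).1 with h | h <;> rcases iv_cases A (en x).2 with h' | h' <;> omega

theorem exc_sum (en : E → V × V) (S : Finset E) (σ : E → ℤ) (A : Finset V) :
    exc en S σ A = ∑ v ∈ A, exc en S σ {v} := by
  unfold exc
  rw [Finset.sum_comm]
  refine Finset.sum_congr rfl fun x _ => ?_
  rw [chi_sum, Finset.mul_sum]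

theorem dd_nonneg (en : E → V × V) (S : Finset E) (A : Finset V) : 0 ≤ dd en S A :=
  Finset.sum_nonneg fun _ _ => abs_nonneg _

theorem PM.abs {σ : E → ℤ} (h : PM σ) (x : E) : |σ x| = 1 := by
  rcases h x with h | h <;> simp [h]

theorem exc_abs_le (en : E → V × V) (S : Finset E) {σ : E → ℤ} (hσ : PM σ) (A : Finset V) :
    |exc en S σ A| ≤ dd en S A := by
  unfold exc dd
  refine (Finset.abs_sum_le_sum_abs _ _).trans (Finset.sum_le_sum fun x _ => ?_)
  rw [abs_mul, hσ.abs, one_mul]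

theorem exc_par (en : E → V × V) (S : Finset E) {σ : E → ℤ} (hσ : PM σ) (A : Finset V) :
    2 ∣ dd en S A - exc en S σ A := by
  unfold exc dd
  rw [← Finset.sum_sub_distrib]
  refine Finset.dvd_sum fun x _ => ?_
  have := two_dvd_abs_sub (chi en A x)
  rcases hσ x with h | h <;> rw [h] <;> omega

theorem dd_par_sum (en : E → V × V) (S : Finset E) (A : Finset V) :
    2 ∣ dd en S A - ∑ v ∈ A, dd en S {v} := by
  have h1 := exc_par en S (σ := fun _ => 1) (fun _ => Or.inl rfl) A
  have h2 : 2 ∣ ∑ v ∈ A, (dd en S {v} - exc en S (fun _ => 1) {v}) :=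
    Finset.dvd_sum fun v _ => exc_par en S (σ := fun _ => 1) (fun _ => Or.inl rfl) {v}
  rw [Finset.sum_sub_distrib, ← exc_sum] at h2
  omega

theorem chi_W (en : E → V × V) {W : Finset V} {x : E} (h : (en x).1 ∈ W ∧ (en x).2 ∈ W) :
    chi en W x = 0 := by
  unfold chi iv; simp [h.1, h.2]

theorem iv_sdiff {W A : Finset V} (hA : A ⊆ W) (v : V) : iv (W \ A) v = iv W v - iv A v := by
  unfold iv
  by_cases h1 : v ∈ W <;> by_cases h2 : v ∈ A
  · simp [h1, h2]
  · simp [h1, h2]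
  · exact absurd (hA h2) h1
  · simp [h1, h2]

theorem dd_compl {en : E → V × V} {S : Finset E} {W A : Finset V} (hA : A ⊆ W)
    (hS : ∀ x ∈ S, (en x).1 ∈ W ∧ (en x).2 ∈ W) : dd en S (W \ A) = dd en S A := by
  unfold dd
  refine Finset.sum_congr rfl fun x hx => ?_
  have h := chi_W en (hS x hx)
  have : chi en (W \ A) x = - chi en A x := by
    unfold chi at *; rw [iv_sdiff hA, iv_sdiff hA]; omega
  rw [this, abs_neg]

theorem dd_W {en : E → V × V} {S : Finset E} {W : Finset V}
    (hS : ∀ x ∈ S, (en x).1 ∈ W ∧ (en x).2 ∈ W) : dd en S W = 0 := by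
  unfold dd
  exact Finset.sum_eq_zero fun x hx => by rw [chi_W en (hS x hx), abs_zero]

/-- an edge leaving `v` has another end `u` -/
theorem edge_form {en : E → V × V} {W : Finset V} {x : E} (h : (en x).1 ∈ W ∧ (en x).2 ∈ W)
    {v : V} (hv : chi en {v} x ≠ 0) :
    ∃ u ∈ W, u ≠ v ∧ ∃ ε : ℤ, (ε = 1 ∨ ε = -1) ∧ ∀ A, chi en A x = ε * (iv A v - iv A u) := by
  unfold chi at hv
  rw [iv_single, iv_single] at hv
  by_cases h1 : (en x).1 = v <;> by_cases h2 : (en x).2 = v <;> simp [h1, h2] at hv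
  · refine ⟨(en x).2, h.2, h2, 1, Or.inl rfl, fun A => ?_⟩
    unfold chi; rw [h1]; ring
  · refine ⟨(en x).1, h.1, h1, -1, Or.inr rfl, fun A => ?_⟩
    unfold chi; rw [h2]; ring

theorem exists_edge_of_dd {en : E → V × V} {S : Finset E} {A : Finset V} (h : dd en S A ≠ 0) :
    ∃ x ∈ S, chi en A x ≠ 0 := by
  by_contra hc
  push Not at hc
  exact h (Finset.sum_eq_zero fun x hx => by rw [hc x hx, abs_zero])

theorem edge_form_cut {en : E → V × V} {W : Finset V} {x : E} (h : (en x).1 ∈ W ∧ (en x).2 ∈ W)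
    {A : Finset V} (hv : chi en A x ≠ 0) :
    ∃ u ∈ W, ∃ v ∈ W, u ∈ A ∧ v ∉ A ∧
      ∃ ε : ℤ, (ε = 1 ∨ ε = -1) ∧ ∀ A, chi en A x = ε * (iv A u - iv A v) := by
  unfold chi at hv
  rcases iv_cases A (en x).1 with h1 | h1 <;> rcases iv_cases A (en x).2 with h2 | h2
  · omega
  · exact ⟨_, h.1, _, h.2, h1.1, h2.1, 1, Or.inl rfl, fun A => by unfold chi; ring⟩
  · exact ⟨_, h.2, _, h.1, h2.1, h1.1, -1, Or.inr rfl, fun A => by unfold chi; ring⟩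
  · omega

theorem exc_del (en : E → V × V) {S : Finset E} {x : E} (hx : x ∈ S) {s : ℤ} (hs : s = 1 ∨ s = -1)
    {σ : E → ℤ} (hσ : PM σ) :
    ∃ σ' : E → ℤ, PM σ' ∧ ∀ A, exc en S σ' A = s * chi en A x + exc en (S.erase x) σ A := by
  refine ⟨Function.update σ x s, fun y => ?_, fun A => ?_⟩
  · by_cases h : y = x
    · subst h; simpa using hs
    · simpa [h] using hσ y
  · unfold exc
    rw [← Finset.add_sum_erase S _ hx]
    congr 1
    · simp
    · refine Finset.sum_congr rfl fun y hy => ?_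
      rw [Function.update_of_ne (Finset.ne_of_mem_erase hy)]

theorem exc_lift (en : E → V × V) {S : Finset E} {x y : E} (hx : x ∈ S) (hy : y ∈ S) (hxy : x ≠ y)
    {u v w : V} {ε₁ ε₂ : ℤ} (h₁ : ε₁ = 1 ∨ ε₁ = -1) (h₂ : ε₂ = 1 ∨ ε₂ = -1)
    (c₁ : ∀ A, chi en A x = ε₁ * (iv A v - iv A u)) (c₂ : ∀ A, chi en A y = ε₂ * (iv A v - iv A w))
    {σ : E → ℤ} (hσ : PM σ) :
    ∃ σ' : E → ℤ, PM σ' ∧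
      ∀ A, exc en S σ' A = exc (Function.update en x (u, w)) (S.erase y) σ A := by
  refine ⟨Function.update (Function.update σ x (-(ε₁ * σ x))) y (ε₂ * σ x), fun z => ?_, fun A => ?_⟩
  · by_cases h : z = y
    · subst h
      rw [Function.update_self]
      rcases h₂ with h | h <;> rcases hσ x with h' | h' <;> simp [h, h']
    · rw [Function.update_of_ne h]
      by_cases h : z = x
      · subst h
        rw [Function.update_self]
        rcases h₁ with h | h <;> rcases hσ z with h' | h' <;> simp [h, h']
      · rw [Function.update_of_ne h]; exact hσ z
  · unfold exc
    have hx' : x ∈ S.erase y := Finset.mem_erase.2 ⟨hxy, hx⟩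
    rw [← Finset.add_sum_erase S _ hy, ← Finset.add_sum_erase _ _ hx',
      ← Finset.add_sum_erase _ _ hx']
    rw [Function.update_self, Function.update_of_ne hxy, Function.update_self, c₁, c₂, ← add_assoc]
    congr 1
    · simp only [chi, Function.update_self]
      rcases h₁ with rfl | rfl <;> rcases h₂ with rfl | rfl <;> ring
    · refine Finset.sum_congr rfl fun z hz => ?_
      have h1 := Finset.mem_erase.1 hz
      have h2 := Finset.mem_erase.1 h1.2
      rw [Function.update_of_ne h2.1, Function.update_of_ne h1.1]
      simp only [chi, Function.update_of_ne h1.1]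

theorem abs_pm_mul {ε : ℤ} (h : ε = 1 ∨ ε = -1) (y : ℤ) : |ε * y| = |y| := by
  rcases h with h | h <;> simp [h]

theorem dd_erase (en : E → V × V) {S : Finset E} {x : E} (hx : x ∈ S) (A : Finset V) :
    dd en (S.erase x) A = dd en S A - |chi en A x| := by
  unfold dd; rw [← Finset.add_sum_erase S _ hx]; ring

theorem dd_lift (en : E → V × V) {S : Finset E} {x y : E} (hx : x ∈ S) (hy : y ∈ S) (hxy : x ≠ y)
    {u v w : V} {ε₁ ε₂ : ℤ} (h₁ : ε₁ = 1 ∨ ε₁ = -1) (h₂ : ε₂ = 1 ∨ ε₂ = -1)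
    (c₁ : ∀ A, chi en A x = ε₁ * (iv A v - iv A u)) (c₂ : ∀ A, chi en A y = ε₂ * (iv A v - iv A w))
    (A : Finset V) :
    dd (Function.update en x (u, w)) (S.erase y) A =
      dd en S A - (|iv A v - iv A u| + |iv A v - iv A w| - |iv A u - iv A w|) := by
  have hx' : x ∈ S.erase y := Finset.mem_erase.2 ⟨hxy, hx⟩
  unfold dd
  rw [← Finset.add_sum_erase S _ hy, ← Finset.add_sum_erase _ _ hx',
      ← Finset.add_sum_erase _ _ hx', c₁, c₂, abs_pm_mul h₁, abs_pm_mul h₂]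
  have : ∑ z ∈ (S.erase y).erase x, |chi (Function.update en x (u, w)) A z| =
      ∑ z ∈ (S.erase y).erase x, |chi en A z| := by
    refine Finset.sum_congr rfl fun z hz => ?_
    simp only [chi, Function.update_of_ne (Finset.mem_erase.1 hz).1]
  rw [this]
  simp only [chi, Function.update_self]
  ring

/-! ### Gluing -/

/-- edges inside `A` -/
def inn (en : E → V × V) (S : Finset E) (A : Finset V) : Finset E :=
  S.filter fun x => (en x).1 ∈ A ∧ (en x).2 ∈ A

/-- edges in the cut of `A` -/
def cutE (en : E → V × V) (S : Finset E) (A : Finset V) : Finset E :=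
  S.filter fun x => chi en A x ≠ 0

theorem sum_split (en : E → V × V) (S : Finset E) {A B : Finset V} (hB : B ⊆ A) (g : E → ℤ)
    (hg : ∀ x ∈ S, chi en B x = 0 → g x = 0) :
    ∑ x ∈ S, g x = ∑ x ∈ inn en S A, g x + ∑ x ∈ cutE en S A, g x := by
  unfold inn cutE
  rw [Finset.sum_filter, Finset.sum_filter, ← Finset.sum_add_distrib]
  refine Finset.sum_congr rfl fun x hx => ?_
  have h := hg x hx
  unfold chi at *
  have h1 := @hB (en x).1
  have h2 := @hB (en x).2
  rcases iv_cases A (en x).1 with a | a <;> rcases iv_cases A (en x).2 with b | b <;>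
    rcases iv_cases B (en x).1 with c | c <;> rcases iv_cases B (en x).2 with d | d <;>
    simp_all

theorem dd_split (en : E → V × V) (S : Finset E) {A B : Finset V} (hB : B ⊆ A) :
    dd en S B = dd en (inn en S A) B + ∑ x ∈ cutE en S A, |chi en B x| :=
  sum_split en S hB _ fun x _ h => by rw [h, abs_zero]

theorem cut_abs_sum (en : E → V × V) (S : Finset E) {A B : Finset V} (hB : B ⊆ A) :
    ∑ x ∈ cutE en S A, |chi en B x| = ∑ v ∈ B, ∑ x ∈ cutE en S A, |chi en {v} x| := by
  rw [Finset.sum_comm]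
  refine Finset.sum_congr rfl fun x hx => ?_
  have hx := (Finset.mem_filter.1 hx).2
  unfold chi at *
  have h1 := @hB (en x).1
  have h2 := @hB (en x).2
  rcases iv_cases A (en x).1 with a | a <;> rcases iv_cases A (en x).2 with b | b
  · omega
  · have hc : (en x).2 ∉ B := fun h => b.1 (h2 h)
    have : ∀ v ∈ B, |iv {v} (en x).1 - iv {v} (en x).2| = iv {v} (en x).1 := by
      intro v hv
      rw [iv_single, iv_single, if_neg (fun h : (en x).2 = v => hc (h ▸ hv))]
      split_ifs <;> simp
    rw [Finset.sum_congr rfl this, ← iv_sum]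
    rcases iv_cases B (en x).1 with c | c <;> rcases iv_cases B (en x).2 with d | d <;> simp_all
  · have hc : (en x).1 ∉ B := fun h => a.1 (h1 h)
    have : ∀ v ∈ B, |iv {v} (en x).1 - iv {v} (en x).2| = iv {v} (en x).2 := by
      intro v hv
      rw [iv_single, iv_single, if_neg (fun h : (en x).1 = v => hc (h ▸ hv))]
      split_ifs <;> simp
    rw [Finset.sum_congr rfl this, ← iv_sum]
    rcases iv_cases B (en x).1 with c | c <;> rcases iv_cases B (en x).2 with d | d <;> simp_all
  · omega

theorem exc_glue (en : E → V × V) (S : Finset E) (A : Finset V) {σ₁ σ₂ : E → ℤ} (h₁ : PM σ₁)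
    (h₂ : PM σ₂) :
    ∃ σ, PM σ ∧ (∀ v ∈ A, exc en S σ {v} =
        exc en (inn en S A) σ₂ {v} + ∑ x ∈ cutE en S A, σ₁ x * chi en {v} x) ∧
      (∀ v ∉ A, exc en S σ {v} = exc en S σ₁ {v}) := by
  refine ⟨fun x => if (en x).1 ∈ A ∧ (en x).2 ∈ A then σ₂ x else σ₁ x, fun x => ?_, fun v hv => ?_,
    fun v hv => ?_⟩
  · dsimp only; split_ifs
    · exact h₂ x
    · exact h₁ x
  · unfold exc
    rw [sum_split en S (Finset.singleton_subset_iff.2 hv)]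
    · congr 1
      · refine Finset.sum_congr rfl fun x hx => ?_
        dsimp only; rw [if_pos (Finset.mem_filter.1 hx).2]
      · refine Finset.sum_congr rfl fun x hx => ?_
        dsimp only; rw [if_neg]
        rintro ⟨h1, h2⟩
        exact (Finset.mem_filter.1 hx).2 (by unfold chi iv; simp [h1, h2])
    · intro x _ h; rw [h, mul_zero]
  · unfold exc
    refine Finset.sum_congr rfl fun x hx => ?_
    dsimp only; split_ifs with h
    · have : chi en {v} x = 0 := by
        unfold chi
        rw [iv_single, iv_single, if_neg, if_neg]
        · rfl
        · rintro rfl; exact hv h.2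
        · rintro rfl; exact hv h.1
      rw [this, mul_zero, mul_zero]
    · rfl

/-- contraction of `A` to `a` -/
def phi (a : V) (A : Finset V) (v : V) : V := if v ∈ A then a else v

def enC (a : V) (A : Finset V) (en : E → V × V) (x : E) : V × V :=
  (phi a A (en x).1, phi a A (en x).2)

def hat (a : V) (A B : Finset V) : Finset V := if a ∈ B then B ∪ A else B

theorem iv_hat {a : V} {A B : Finset V} (ha : a ∈ A) (hB : ∀ v ∈ B, v ∈ A → v = a) (v : V) :
    iv B (phi a A v) = iv (hat a A B) v := by
  unfold iv phi hat
  have := hB v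
  by_cases h1 : v ∈ A <;> by_cases h2 : a ∈ B <;> simp [h1, h2]
  intro h; have := this h h1; subst this; exact h2 h

theorem chi_hat {a : V} {A B : Finset V} (ha : a ∈ A) (hB : ∀ v ∈ B, v ∈ A → v = a)
    (en : E → V × V) (x : E) : chi (enC a A en) B x = chi en (hat a A B) x := by
  unfold chi enC; rw [iv_hat ha hB, iv_hat ha hB]

theorem dd_hat {a : V} {A B : Finset V} (ha : a ∈ A) (hB : ∀ v ∈ B, v ∈ A → v = a)
    (en : E → V × V) (S : Finset E) : dd (enC a A en) S B = dd en S (hat a A B) := by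
  unfold dd; exact Finset.sum_congr rfl fun x _ => by rw [chi_hat ha hB]

theorem exc_hat {a : V} {A B : Finset V} (ha : a ∈ A) (hB : ∀ v ∈ B, v ∈ A → v = a)
    (en : E → V × V) (S : Finset E) (σ : E → ℤ) :
    exc (enC a A en) S σ B = exc en S σ (hat a A B) := by
  unfold exc; exact Finset.sum_congr rfl fun x _ => by rw [chi_hat ha hB]

/-- contracted weights -/
def conW (a : V) (A : Finset V) (g : V → ℤ) (v : V) : ℤ := if v = a then ∑ u ∈ A, g u else g v

theorem sum_hat {a : V} {A B : Finset V} (ha : a ∈ A) (hB : ∀ v ∈ B, v ∈ A → v = a)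
    (g : V → ℤ) : ∑ v ∈ B, conW a A g v = ∑ v ∈ hat a A B, g v := by
  unfold conW hat
  by_cases h : a ∈ B
  · rw [if_pos h, ← Finset.add_sum_erase B _ h, if_pos rfl]
    have : B ∪ A = A ∪ B.erase a := by
      ext v; simp only [Finset.mem_union, Finset.mem_erase]
      constructor
      · rintro (h1 | h1)
        · by_cases h2 : v = a
          · subst h2; exact Or.inl ha
          · exact Or.inr ⟨h2, h1⟩
        · exact Or.inl h1
      · rintro (h1 | h1)
        · exact Or.inr h1
        · exact Or.inl h1.2
    rw [this, Finset.sum_union]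
    · congr 1
      exact Finset.sum_congr rfl fun v hv => if_neg (Finset.ne_of_mem_erase hv)
    · rw [Finset.disjoint_left]
      intro v h1 h2
      exact Finset.ne_of_mem_erase h2 (hB v (Finset.mem_of_mem_erase h2) h1)
  · rw [if_neg h]
    refine Finset.sum_congr rfl fun v hv => if_neg ?_
    rintro rfl; exact h hv

theorem phi_mem {a : V} {A W : Finset V} {v : V} (hv : v ∈ W) :
    phi a A v ∈ insert a (W \ A) := by
  unfold phi; split_ifs with h <;> simp [h, hv]

theorem hat_subset {a : V} {A B W : Finset V} (hA : A ⊆ W) (ha : a ∈ A) (hB : B ⊆ insert a (W \ A)) :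
    hat a A B ⊆ W := by
  have : B ⊆ W := fun v hv => by
    rcases Finset.mem_insert.1 (hB hv) with h | h
    · subst h; exact hA ha
    · exact (Finset.mem_sdiff.1 h).1
  unfold hat; split_ifs
  · exact Finset.union_subset this hA
  · exact this

theorem conB {a : V} {A B W : Finset V} (hB : B ⊆ insert a (W \ A)) : ∀ v ∈ B, v ∈ A → v = a := by
  intro v hv hvA
  rcases Finset.mem_insert.1 (hB hv) with h | h
  · exact h
  · exact absurd hvA (Finset.mem_sdiff.1 h).2

theorem hat_W {a : V} {A W : Finset V} (hA : A ⊆ W) (ha : a ∈ A) :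
    hat a A (insert a (W \ A)) = W := by
  unfold hat
  rw [if_pos (Finset.mem_insert_self _ _)]
  ext v
  have := @hA v
  have := hA ha
  simp only [Finset.mem_union, Finset.mem_insert, Finset.mem_sdiff]
  constructor
  · rintro ((rfl | h) | h) <;> tauto
  · intro h; by_cases h' : v ∈ A <;> tauto

theorem hat_ne_W {a : V} {A B W : Finset V} (hA : A ⊆ W) (ha : a ∈ A)
    (hB : B ⊆ insert a (W \ A)) (hne : B ≠ insert a (W \ A)) : hat a A B ≠ W := by
  intro h
  apply hne
  refine Finset.Subset.antisymm hB fun v hv => ?_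
  unfold hat at h
  split_ifs at h with h1
  · rcases Finset.mem_insert.1 hv with rfl | h2
    · exact h1
    · rw [Finset.mem_sdiff] at h2
      have : v ∈ B ∪ A := h ▸ h2.1
      rcases Finset.mem_union.1 this with h3 | h3
      · exact h3
      · exact absurd h3 h2.2
  · exact absurd (h ▸ hA ha) h1

theorem hat_single_a {a : V} {A : Finset V} (ha : a ∈ A) : hat a A {a} = A := by
  unfold hat; simp [ha]

theorem hat_single_ne {a v : V} {A : Finset V} (h : v ≠ a) : hat a A {v} = {v} := by
  unfold hat; simp [Ne.symm h]

theorem card_con {a : V} {A W : Finset V} (hA : A ⊆ W) (ha : a ∈ A) :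
    (insert a (W \ A)).card + A.card = W.card + 1 := by
  rw [Finset.card_insert_of_notMem (by simp [ha]), Finset.card_sdiff_of_subset hA]
  have := Finset.card_le_card hA
  omega

end basics



/-! ### Orientations modulo `2 * k`: instances -/

section stepI
variable [DecidableEq V] [DecidableEq E]

structure Inst (k : ℤ) (W : Finset V) (S : Finset E) (en : E → V × V) (r e q : V → ℤ)
    (X : Set V) : Prop where
  ends : ∀ x ∈ S, (en x).1 ∈ W ∧ (en x).2 ∈ W
  par : ∀ v ∈ W, 2 ∣ dd en S {v} - r v
  sum : 2 * k ∣ ∑ v ∈ W, r v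
  qe : ∀ v ∈ W, |q v| ≤ e v
  qp : ∀ v ∈ W, 2 ∣ e v - q v
  xs : X.Subsingleton
  xz : ∀ v ∈ X, v ∈ W → 2 * k ∣ r v + q v
  c1 : ∀ A ⊆ W, A.Nonempty → A ≠ W → (∀ x ∈ X, A ≠ {x}) →
    2 * k - 2 + tk k (∑ v ∈ A, (r v + q v)) ≤ dd en S A + ∑ v ∈ A, e v
  c2 : ∑ v ∈ W, e v ≤ 2 * k - 2 + tk k (∑ v ∈ W, q v)

def Sol (k : ℤ) (W : Finset V) (S : Finset E) (en : E → V × V) (r : V → ℤ) : Prop :=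
  ∃ σ : E → ℤ, PM σ ∧ ∀ v ∈ W, 2 * k ∣ exc en S σ {v} - r v

def Slk (k : ℤ) (W : Finset V) (S : Finset E) (en : E → V × V) (r e q : V → ℤ) : Prop :=
  ∀ A ⊆ W, 2 ≤ A.card → A ≠ W →
    2 * k + tk k (∑ v ∈ A, (r v + q v)) ≤ dd en S A + ∑ v ∈ A, e v

variable {k : ℤ} {W : Finset V} {S : Finset E} {en : E → V × V} {r e q : V → ℤ} {X : Set V}

theorem sum_iv (A : Finset V) (v : V) : ∑ w ∈ A, iv {v} w = iv A v := by
  unfold iv; simp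

theorem sum_chi (A : Finset V) (x : E) : ∑ w ∈ A, chi en {w} x = chi en A x := (chi_sum en A x).symm

theorem Inst.parA (hk : 0 < k) (h : Inst k W S en r e q X) {A : Finset V} (hA : A ⊆ W) :
    2 ∣ dd en S A + ∑ v ∈ A, e v - tk k (∑ v ∈ A, (r v + q v)) := by
  have h1 := dd_par_sum en S A
  have h2 := tk_par hk (∑ v ∈ A, (r v + q v))
  have h3 : 2 ∣ ∑ v ∈ A, ((dd en S {v} - r v) + (e v - q v)) :=
    Finset.dvd_sum fun v hv => dvd_add (h.par v (hA hv)) (h.qp v (hA hv))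
  simp only [Finset.sum_add_distrib, Finset.sum_sub_distrib] at *
  omega

theorem tk_shift {x y : ℤ} (h : 2 * k ∣ x) : tk k (x + y) = tk k y :=
  tk_congr (by simpa using h)

theorem base (hI : Inst k W S en r e q X) (h1 : W.card ≤ 1) : Sol k W S en r := by
  refine ⟨fun _ => 1, fun _ => Or.inl rfl, fun v hv => ?_⟩
  have hW : W = {v} := by
    refine (Finset.eq_of_subset_of_card_le (Finset.singleton_subset_iff.2 hv) ?_).symm
    simpa using h1
  have h2 := hI.sum
  rw [hW, Finset.sum_singleton] at h2
  have : exc en S (fun _ => 1) {v} = 0 := by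
    unfold exc
    refine Finset.sum_eq_zero fun x hx => ?_
    rw [← hW, chi_W en (hI.ends x hx), mul_zero]
  rw [this]; simpa using h2

theorem contract (hk : 0 < k)
    (IH : ∀ (W' : Finset V) (S' : Finset E) (en' : E → V × V) (r' e' q' : V → ℤ) (X' : Set V),
      W'.card < W.card → Inst k W' S' en' r' e' q' X' → Sol k W' S' en' r')
    (hI : Inst k W S en r e q X) {A : Finset V} (hA : A ⊆ W) (hA2 : 2 ≤ A.card) (hAW : A ≠ W)
    (ht : dd en S A + ∑ v ∈ A, e v ≤ 2 * k - 2 + tk k (∑ v ∈ A, (r v + q v))) :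
    Sol k W S en r := by
  have hne : A.Nonempty := Finset.card_pos.1 (by omega)
  obtain ⟨a, ha⟩ := hne
  have hc := card_con hA ha
  have hlt : A.card < W.card := Finset.card_lt_card (Finset.ssubset_iff_subset_ne.2 ⟨hA, hAW⟩)
  have sh : ∀ B : Finset V, (∀ v ∈ B, v ∈ A → v = a) → ∀ g : V → ℤ,
      ∑ v ∈ B, conW a A g v = ∑ v ∈ hat a A B, g v := fun B hB g => sum_hat ha hB g
  have sh2 : ∀ B : Finset V, (∀ v ∈ B, v ∈ A → v = a) →
      ∑ v ∈ B, (conW a A r v + conW a A q v) = ∑ v ∈ hat a A B, (r v + q v) := by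
    intro B hB; rw [Finset.sum_add_distrib, Finset.sum_add_distrib, sh B hB, sh B hB]
  have hs : ∀ v ∈ insert a (W \ A), ∀ u ∈ ({v} : Finset V), u ∈ A → u = a := fun v hv =>
    conB (W := W) (Finset.singleton_subset_iff.2 hv)
  have hs1 : ∀ v ∈ insert a (W \ A), ∀ g : V → ℤ, conW a A g v = ∑ u ∈ hat a A {v}, g u := by
    intro v hv g; rw [← sh _ (hs v hv) g, Finset.sum_singleton]
  have hsub : ∀ v ∈ insert a (W \ A), hat a A {v} ⊆ W := fun v hv =>
    hat_subset hA ha (Finset.singleton_subset_iff.2 hv)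
  have hI1 : Inst k (insert a (W \ A)) S (enC a A en) (conW a A r) (conW a A e) (conW a A q)
      (X \ A) := by
    refine ⟨fun x hx => ⟨phi_mem (hI.ends x hx).1, phi_mem (hI.ends x hx).2⟩, fun v hv => ?_, ?_,
      fun v hv => ?_, fun v hv => ?_, hI.xs.anti Set.sdiff_subset, ?_, ?_, ?_⟩
    · rw [dd_hat ha (hs v hv), hs1 v hv]
      have h1 := dd_par_sum en S (hat a A {v})
      have h2 : 2 ∣ ∑ u ∈ hat a A {v}, (dd en S {u} - r u) :=
        Finset.dvd_sum fun u hu => hI.par u (hsub v hv hu)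
      rw [Finset.sum_sub_distrib] at h2
      omega
    · rw [sh _ (conB subset_rfl), hat_W hA ha]; exact hI.sum
    · rw [hs1 v hv, hs1 v hv]
      exact (Finset.abs_sum_le_sum_abs _ _).trans
        (Finset.sum_le_sum fun u hu => hI.qe u (hsub v hv hu))
    · rw [hs1 v hv, hs1 v hv, ← Finset.sum_sub_distrib]
      exact Finset.dvd_sum fun u hu => hI.qp u (hsub v hv hu)
    · rintro v ⟨hvX, hvA⟩ hv
      have hva : v ≠ a := fun h => hvA (h ▸ ha)
      have hvW : v ∈ W := by
        rcases Finset.mem_insert.1 hv with h | h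
        · exact absurd h hva
        · exact (Finset.mem_sdiff.1 h).1
      unfold conW; rw [if_neg hva, if_neg hva]; exact hI.xz v hvX hvW
    · intro B hB hBne hBW hBX
      rw [sh2 B (conB hB), sh B (conB hB), dd_hat ha (conB hB)]
      refine hI.c1 _ (hat_subset hA ha hB) ?_ (hat_ne_W hA ha hB hBW) ?_
      · obtain ⟨b, hb⟩ := hBne
        refine ⟨b, ?_⟩
        unfold hat; split_ifs
        · exact Finset.mem_union_left _ hb
        · exact hb
      · intro x hx heq
        unfold hat at heq
        split_ifs at heq with h1
        · have : A ⊆ {x} := heq ▸ Finset.subset_union_right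
          have := Finset.card_le_card this
          simp at this; omega
        · refine hBX x ⟨hx, ?_⟩ heq
          intro hxA
          have hxB : x ∈ B := heq ▸ Finset.mem_singleton_self x
          have := conB hB x hxB hxA
          subst this; exact h1 hxB
    · rw [sh _ (conB subset_rfl), sh _ (conB subset_rfl), hat_W hA ha]; exact hI.c2
  obtain ⟨σ₁, hσ₁, h1⟩ := IH _ _ _ _ _ _ _ (by omega) hI1
  have hout : ∀ v ∈ W, v ∉ A → 2 * k ∣ exc en S σ₁ {v} - r v := by
    intro v hv hvA
    have hva : v ≠ a := fun h => hvA (h ▸ ha)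
    have hv1 : v ∈ insert a (W \ A) := by simp [hv, hvA]
    have := h1 v hv1
    rw [exc_hat ha (hs v hv1), hat_single_ne hva] at this
    unfold conW at this; rwa [if_neg hva] at this
  have hin : 2 * k ∣ exc en S σ₁ A - ∑ v ∈ A, r v := by
    have := h1 a (Finset.mem_insert_self _ _)
    rw [exc_hat ha (hs a (Finset.mem_insert_self _ _)), hat_single_a ha] at this
    unfold conW at this; rwa [if_pos rfl] at this
  have hexA : exc en S σ₁ A = ∑ v ∈ A, ∑ x ∈ cutE en S A, σ₁ x * chi en {v} x := by
    rw [Finset.sum_comm]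
    have h2 : exc en S σ₁ A = ∑ x ∈ cutE en S A, σ₁ x * chi en A x := by
      unfold exc cutE
      rw [Finset.sum_filter]
      refine Finset.sum_congr rfl fun x _ => ?_
      split_ifs with h
      · rfl
      · rw [not_not.1 h, mul_zero]
    rw [h2]
    refine Finset.sum_congr rfl fun x _ => ?_
    rw [chi_sum, Finset.mul_sum]
  have hddA : dd en S A = ∑ v ∈ A, ∑ x ∈ cutE en S A, |chi en {v} x| := by
    rw [← cut_abs_sum en S subset_rfl]
    unfold dd cutE
    rw [Finset.sum_filter]
    refine Finset.sum_congr rfl fun x _ => ?_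
    split_ifs with h
    · rfl
    · rw [not_not.1 h, abs_zero]
  have hI2 : Inst k A (inn en S A) en (fun v => r v - ∑ x ∈ cutE en S A, σ₁ x * chi en {v} x)
      (fun v => e v + ∑ x ∈ cutE en S A, |chi en {v} x|)
      (fun v => q v + ∑ x ∈ cutE en S A, σ₁ x * chi en {v} x) X := by
    have hpar : ∀ v, 2 ∣ ∑ x ∈ cutE en S A, |chi en {v} x| -
        ∑ x ∈ cutE en S A, σ₁ x * chi en {v} x := fun v => exc_par en (cutE en S A) hσ₁ {v}
    have hp : ∀ B : Finset V, ∑ v ∈ B, (r v - ∑ x ∈ cutE en S A, σ₁ x * chi en {v} x +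
        (q v + ∑ x ∈ cutE en S A, σ₁ x * chi en {v} x)) = ∑ v ∈ B, (r v + q v) :=
      fun B => Finset.sum_congr rfl fun v _ => by ring
    refine ⟨fun x hx => (Finset.mem_filter.1 hx).2, fun v hv => ?_, ?_, fun v hv => ?_,
      fun v hv => ?_, hI.xs, ?_, ?_, ?_⟩
    · have h2 := dd_split en S (Finset.singleton_subset_iff.2 hv)
      have h3 := hI.par v (hA hv)
      have h4 := hpar v
      omega
    · rw [Finset.sum_sub_distrib, ← hexA]
      rw [← dvd_neg]; simpa using hin
    · refine (abs_add_le _ _).trans (add_le_add (hI.qe v (hA hv)) ?_)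
      exact exc_abs_le en (cutE en S A) hσ₁ {v}
    · have h3 := hI.qp v (hA hv)
      have h4 := hpar v
      omega
    · intro v hvX hv
      have := hI.xz v hvX (hA hv)
      have h5 := hp {v}
      rw [Finset.sum_singleton, Finset.sum_singleton] at h5
      rw [h5]; exact this
    · intro B hB hBne hBA hBX
      rw [hp]
      have h5 : ∑ v ∈ B, (e v + ∑ x ∈ cutE en S A, |chi en {v} x|) =
          ∑ v ∈ B, e v + ∑ x ∈ cutE en S A, |chi en B x| := by
        rw [Finset.sum_add_distrib, ← cut_abs_sum en S hB]
      rw [h5]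
      have h2 := dd_split en S hB
      have h3 := hI.c1 B (hB.trans hA) hBne (fun h => hAW (Finset.Subset.antisymm hA (h ▸ hB))) hBX
      omega
    · rw [Finset.sum_add_distrib, Finset.sum_add_distrib, ← hddA, ← hexA]
      have : tk k (∑ v ∈ A, q v + exc en S σ₁ A) = tk k (∑ v ∈ A, (r v + q v)) := by
        refine tk_congr ?_
        rw [Finset.sum_add_distrib]
        convert hin using 1; ring
      rw [this]; linarith
  obtain ⟨σ₂, hσ₂, h2⟩ := IH _ _ _ _ _ _ _ hlt hI2
  obtain ⟨σ, hσ, g1, g2⟩ := exc_glue en S A hσ₁ hσ₂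
  refine ⟨σ, hσ, fun v hv => ?_⟩
  by_cases hvA : v ∈ A
  · rw [g1 v hvA]
    have := h2 v hvA
    convert this using 1; ring
  · rw [g2 v hvA]; exact hout v hv hvA

theorem slack_or (hk : 0 < k)
    (IH : ∀ (W' : Finset V) (S' : Finset E) (en' : E → V × V) (r' e' q' : V → ℤ) (X' : Set V),
      W'.card < W.card → Inst k W' S' en' r' e' q' X' → Sol k W' S' en' r')
    (hI : Inst k W S en r e q X) : Sol k W S en r ∨ Slk k W S en r e q := by
  by_cases h : Slk k W S en r e q
  · exact Or.inr h
  · left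
    unfold Slk at h
    push Not at h
    obtain ⟨A, hA, hA2, hAW, h⟩ := h
    refine contract hk IH hI hA hA2 hAW ?_
    have := hI.parA hk hA
    omega

theorem sol_del {x : E} (hx : x ∈ S) {s : ℤ} (hs : s = 1 ∨ s = -1)
    (h : Sol k W (S.erase x) en (fun v => r v - s * chi en {v} x)) : Sol k W S en r := by
  obtain ⟨σ, hσ, h⟩ := h
  obtain ⟨σ', hσ', h'⟩ := exc_del en hx hs hσ
  refine ⟨σ', hσ', fun v hv => ?_⟩
  rw [h']
  have := h v hv
  convert this using 1; ring

theorem sol_neg (h : Sol k W S en (fun v => - r v)) : Sol k W S en r := by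
  obtain ⟨σ, hσ, h⟩ := h
  refine ⟨fun x => - σ x, fun x => ?_, fun v hv => ?_⟩
  · rcases hσ x with h | h <;> simp [h]
  · have h1 := h v hv
    rw [← dvd_neg]
    have : exc en S (fun x => - σ x) {v} = - exc en S σ {v} := by
      unfold exc; rw [← Finset.sum_neg_distrib]; exact Finset.sum_congr rfl fun x _ => by ring
    have e1 : -(-exc en S σ {v} - r v) = exc en S σ {v} - (- r v) := by ring
    rw [this, e1]; exact h1

theorem Inst.mono (hI : Inst k W S en r e q X) {X' : Set V} (hs : X'.Subsingleton)
    (hz : ∀ v ∈ X', v ∈ W → 2 * k ∣ r v + q v) (h : ∀ x ∈ X, x ∈ W → x ∈ X') :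
    Inst k W S en r e q X' := by
  refine ⟨hI.ends, hI.par, hI.sum, hI.qe, hI.qp, hs, hz, fun A hA hne hW hX => ?_, hI.c2⟩
  refine hI.c1 A hA hne hW fun x hx heq => ?_
  exact hX x (h x hx (hA (heq ▸ Finset.mem_singleton_self x))) heq

theorem card_two_of {A : Finset V} {v w : V} (hv : v ∈ A) (hw : w ∈ A) (h : v ≠ w) : 2 ≤ A.card := by
  have : ({v, w} : Finset V) ⊆ A := by
    intro z hz; simp at hz; rcases hz with rfl | rfl <;> assumption
  have := Finset.card_le_card this
  rwa [Finset.card_pair h] at this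

theorem card_two_of_ne {A : Finset V} {v : V} (hv : v ∈ A) (h : A ≠ {v}) : 2 ≤ A.card := by
  by_contra hc
  apply h
  refine (Finset.eq_of_subset_of_card_le (Finset.singleton_subset_iff.2 hv) ?_).symm
  simp; omega

end stepI



section exempt
variable [DecidableEq V] [DecidableEq E]
variable {k : ℤ} {W : Finset V} {S : Finset E} {en : E → V × V} {r e q : V → ℤ}

theorem ex_lift {v u w : V} (hI : Inst k W S en r e q {v}) (hS : Slk k W S en r e q)
    {x y : E} (hx : x ∈ S) (hy : y ∈ S) (hxy : x ≠ y)
    {ε₁ ε₂ : ℤ} (h₁ : ε₁ = 1 ∨ ε₁ = -1) (h₂ : ε₂ = 1 ∨ ε₂ = -1)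
    (c₁ : ∀ A, chi en A x = ε₁ * (iv A v - iv A u)) (c₂ : ∀ A, chi en A y = ε₂ * (iv A v - iv A w))
    (hu : u ∈ W) (hw : w ∈ W) (huw : u ≠ w) :
    Inst k W (S.erase y) (Function.update en x (u, w)) r e q {v} := by
  have hl := dd_lift en hx hy hxy h₁ h₂ c₁ c₂
  refine ⟨fun z hz => ?_, fun z hz => ?_, hI.sum, hI.qe, hI.qp, hI.xs, hI.xz, ?_, hI.c2⟩
  · by_cases h : z = x
    · subst h; simp [hu, hw]
    · rw [Function.update_of_ne h]; exact hI.ends z (Finset.mem_of_mem_erase hz)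
  · rw [hl]
    have := hI.par z hz
    rcases iv_cases {z} v with a | a <;> rcases iv_cases {z} u with b | b <;>
      rcases iv_cases {z} w with c | c <;> rw [a.2, b.2, c.2] <;> norm_num <;> omega
  · intro A hA hne hAW hX
    have h1 := hI.c1 A hA hne hAW hX
    have h2 := hS A hA
    have h3 : A ≠ {v} := hX v rfl
    rw [hl]
    rcases iv_cases A v with a | a <;> rcases iv_cases A u with b | b <;>
      rcases iv_cases A w with c | c <;> rw [a.2, b.2, c.2] <;> norm_num
    · linarith
    · linarith
    · linarith
    · have := h2 (card_two_of_ne a.1 h3) hAW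
      linarith
    · have := h2 (card_two_of b.1 c.1 huw) hAW
      linarith
    · linarith
    · linarith
    · linarith

theorem ex_move {v u : V} (hI : Inst k W S en r e q {v}) (hS : Slk k W S en r e q)
    {x : E} (hx : x ∈ S) {ε : ℤ} (hε : ε = 1 ∨ ε = -1)
    (c : ∀ A, chi en A x = ε * (iv A v - iv A u)) (hv : v ∈ W) (hu : u ∈ W) (huv : u ≠ v)
    {t : ℤ} (ht : t = 1 ∨ t = -1) (hq : |q v - t| ≤ e v - 1) :
    Inst k W (S.erase x) en (fun w => r w - (-(t * ε)) * chi en {w} x)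
      (fun w => e w - iv {v} w + iv {u} w) (fun w => q w - t * iv {v} w + t * iv {u} w) {v} := by
  have hp : ∀ w, r w - (-(t * ε)) * chi en {w} x + (q w - t * iv {v} w + t * iv {u} w) =
      r w + q w := by
    intro w
    have h1 : iv {w} v = iv {v} w := by rw [iv_single, iv_single]; simp [eq_comm]
    have h2 : iv {w} u = iv {u} w := by rw [iv_single, iv_single]; simp [eq_comm]
    rw [c, h1, h2]
    rcases hε with rfl | rfl <;> ring
  have hd := dd_erase en hx
  have habs : ∀ A, |chi en A x| = |iv A v - iv A u| := fun A => by rw [c, abs_pm_mul hε]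
  have hse : ∀ A : Finset V, ∑ w ∈ A, (e w - iv {v} w + iv {u} w) =
      ∑ w ∈ A, e w - iv A v + iv A u := by
    intro A; rw [Finset.sum_add_distrib, Finset.sum_sub_distrib, sum_iv, sum_iv]
  refine ⟨fun z hz => hI.ends z (Finset.mem_of_mem_erase hz), fun z hz => ?_, ?_, fun z hz => ?_,
    fun z hz => ?_, hI.xs, ?_, ?_, ?_⟩
  · rw [hd]
    have h1 := hI.par z hz
    have h2 := two_dvd_abs_sub (chi en {z} x)
    rcases hε with rfl | rfl <;> rcases ht with rfl | rfl <;> norm_num <;> omega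
  · rw [Finset.sum_sub_distrib, ← Finset.mul_sum, sum_chi, chi_W en (hI.ends x hx)]
    simpa using hI.sum
  · have h1 := hI.qe z hz
    rw [iv_single, iv_single]
    by_cases a : z = v
    · have b : z ≠ u := fun h => huv (h.symm.trans a)
      rw [if_pos a, if_neg b, a]; simpa using hq
    · rw [if_neg a]
      split_ifs
      · simp only [mul_zero, sub_zero, mul_one]
        refine (abs_add_le _ _).trans ?_
        rcases ht with rfl | rfl <;> norm_num <;> exact h1
      · simpa using h1
  · have h1 := hI.qp z hz
    rcases ht with rfl | rfl <;> omega
  · intro z hz hzW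
    rw [hp]; exact hI.xz z hz hzW
  · intro A hA hne hAW hX
    have h1 := hI.c1 A hA hne hAW hX
    have h2 := hS A hA
    have h3 : A ≠ {v} := hX v rfl
    rw [Finset.sum_congr rfl fun w _ => hp w, hd, hse, habs]
    rcases iv_cases A v with a | a <;> rcases iv_cases A u with b | b <;>
      rw [a.2, b.2] <;> norm_num
    · linarith
    · have := h2 (card_two_of_ne a.1 h3) hAW
      linarith
    · linarith
    · linarith
  · have h1 := hI.c2
    rw [hse, Finset.sum_add_distrib, Finset.sum_sub_distrib, ← Finset.mul_sum, ← Finset.mul_sum,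
      sum_iv, sum_iv]
    unfold iv
    rw [if_pos hv, if_pos hu]
    convert h1 using 1
    · ring
    · congr 2; ring

theorem balanced (T : Finset E) (h : 2 ∣ T.card) : ∃ τ : E → ℤ, PM τ ∧ ∑ x ∈ T, τ x = 0 := by
  obtain ⟨m, hm⟩ := h
  obtain ⟨T', hT', hc⟩ := Finset.exists_subset_card_eq (s := T) (n := m) (by omega)
  refine ⟨fun x => if x ∈ T' then 1 else -1, fun x => ?_, ?_⟩
  · dsimp only; split_ifs <;> simp
  · rw [Finset.sum_ite, Finset.sum_const, Finset.sum_const, Finset.filter_mem_eq_inter,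
      Finset.inter_eq_right.2 hT', Finset.filter_notMem_eq_sdiff, Finset.card_sdiff_of_subset hT', hc, hm]
    simp; omega

theorem ex_remove {v u : V}
    (IH : ∀ (W' : Finset V) (S' : Finset E) (en' : E → V × V) (r' e' q' : V → ℤ) (X' : Set V),
      W'.card < W.card → Inst k W' S' en' r' e' q' X' → Sol k W' S' en' r')
    (hI : Inst k W S en r e q {v}) (hv : v ∈ W) (hu : u ∈ W) (huv : u ≠ v)
    (he : e v = 0)
    (hall : ∀ x ∈ S, chi en {v} x ≠ 0 → ∃ ε : ℤ, (ε = 1 ∨ ε = -1) ∧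
      ∀ A, chi en A x = ε * (iv A v - iv A u)) : Sol k W S en r := by
  have hq : q v = 0 := by
    have := hI.qe v hv; rw [he] at this; exact abs_nonpos_iff.1 this
  have hr : 2 * k ∣ r v := by
    have := hI.xz v rfl hv; rwa [hq, add_zero] at this
  -- cases on edges
  have hedge : ∀ x ∈ S, x ∉ inn en S (W.erase v) → chi en {v} x = 0 → ∀ A, chi en A x = 0 := by
    intro x hx hn h0 A
    have h1 := hI.ends x hx
    unfold chi at h0 ⊢
    rw [iv_single, iv_single] at h0
    have : (en x).1 = v ∧ (en x).2 = v := by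
      by_contra hc
      have : (en x).1 ≠ v ∧ (en x).2 ≠ v := by
        by_cases h2 : (en x).1 = v <;> by_cases h3 : (en x).2 = v <;> simp_all
      exact hn (Finset.mem_filter.2 ⟨hx, Finset.mem_erase.2 ⟨this.1, h1.1⟩,
        Finset.mem_erase.2 ⟨this.2, h1.2⟩⟩)
    rw [this.1, this.2, sub_self]
  have hinn : ∀ x ∈ inn en S (W.erase v), chi en {v} x = 0 := by
    intro x hx
    have h1 := (Finset.mem_filter.1 hx).2
    unfold chi; rw [iv_single, iv_single, if_neg (Finset.ne_of_mem_erase h1.1),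
      if_neg (Finset.ne_of_mem_erase h1.2)]; rfl
  have hddinn : ∀ B : Finset V, iv B v = iv B u → dd en (inn en S (W.erase v)) B = dd en S B := by
    intro B hB
    unfold dd
    refine Finset.sum_subset (Finset.filter_subset _ _) fun x hx hn => ?_
    by_cases h0 : chi en {v} x = 0
    · rw [hedge x hx hn h0, abs_zero]
    · obtain ⟨ε, -, h⟩ := hall x hx h0
      rw [h, hB, sub_self, mul_zero, abs_zero]
  have hddins : ∀ B : Finset V, v ∉ B → dd en (inn en S (W.erase v)) B =
      dd en (inn en S (W.erase v)) (insert v B) := by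
    intro B hB
    unfold dd
    refine Finset.sum_congr rfl fun x hx => ?_
    have h1 := (Finset.mem_filter.1 hx).2
    have h2 : ∀ w ∈ W.erase v, iv (insert v B) w = iv B w := by
      intro w hw; unfold iv; simp [Finset.ne_of_mem_erase hw]
    unfold chi; rw [h2 _ h1.1, h2 _ h1.2]
  have hdd : ∀ A ⊆ W.erase v, dd en (inn en S (W.erase v)) A =
      dd en S (if u ∈ A then insert v A else A) := by
    intro A hA
    have hvA : v ∉ A := fun h => (Finset.mem_erase.1 (hA h)).1 rfl
    split_ifs with h
    · rw [hddins A hvA, hddinn]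
      unfold iv; simp [h]
    · rw [hddinn]
      unfold iv; simp [h, hvA]
  have hpar2 : 2 ∣ dd en S {v} := by
    have h1 := hI.par v hv
    have h2 : (2:ℤ) ∣ r v := dvd_trans ⟨k, rfl⟩ hr
    omega
  have hI' : Inst k (W.erase v) (inn en S (W.erase v)) en r e q ∅ := by
    have hsub : W.erase v ⊆ W := Finset.erase_subset _ _
    refine ⟨fun x hx => (Finset.mem_filter.1 hx).2, fun z hz => ?_, ?_,
      fun z hz => hI.qe z (hsub hz), fun z hz => hI.qp z (hsub hz), Set.subsingleton_empty,
      by simp, ?_, ?_⟩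
    · rw [hdd _ (Finset.singleton_subset_iff.2 hz)]
      have h1 := hI.par z (hsub hz)
      split_ifs with h
      · have h2 := dd_par_sum en S (insert v {z})
        rw [Finset.sum_insert (by simpa using (Finset.ne_of_mem_erase hz).symm),
          Finset.sum_singleton] at h2
        omega
      · exact h1
    · have h1 := hI.sum
      rw [← Finset.add_sum_erase W _ hv] at h1
      exact (dvd_add_right hr).1 h1
    · intro A hA hne hAW _
      have hvA : v ∉ A := fun h => (Finset.mem_erase.1 (hA h)).1 rfl
      rw [hdd A hA]
      split_ifs with h
      · have h1 := hI.c1 (insert v A) (Finset.insert_subset hv (hA.trans hsub)) (by simp)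
          (fun h => hAW (by rw [← h, Finset.erase_insert hvA])) (by
            rintro x rfl heq
            have : u ∈ ({x} : Finset V) := heq ▸ Finset.mem_insert_of_mem h
            exact huv (Finset.mem_singleton.1 this))
        rw [Finset.sum_insert hvA, Finset.sum_insert hvA, he, tk_shift (hI.xz v rfl hv)] at h1
        linarith
      · refine hI.c1 A (hA.trans hsub) hne ?_ ?_
        · rintro rfl; exact hvA hv
        · rintro x rfl rfl; simp at hvA
    · have h1 := hI.c2
      rw [← Finset.add_sum_erase W _ hv, ← Finset.add_sum_erase W _ hv, he, hq] at h1
      simpa using h1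
  obtain ⟨σ', hσ', h'⟩ := IH _ _ _ _ _ _ _ (Finset.card_erase_lt_of_mem hv) hI'
  set T := S.filter fun x => chi en {v} x ≠ 0 with hT
  have hcard : (T.card : ℤ) = dd en S {v} := by
    unfold dd
    rw [hT, Finset.card_filter]
    push_cast
    refine Finset.sum_congr rfl fun x _ => ?_
    rcases chi_cases en {v} x with h | h | h <;> simp [h]
  obtain ⟨τ, hτ, hτ0⟩ := balanced T (by omega)
  have hc1 : ∀ x, chi en {v} x ≠ 0 → chi en {v} x = 1 ∨ chi en {v} x = -1 := fun x h => by
    rcases chi_cases en {v} x with h' | h'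
    · exact absurd h' h
    · exact h'
  refine ⟨fun x => if chi en {v} x ≠ 0 then chi en {v} x * τ x else σ' x, fun x => ?_, ?_⟩
  · dsimp only; split_ifs with h
    · rcases hc1 x h with h | h <;> rcases hτ x with h' | h' <;> simp [h, h']
    · exact hσ' x
  have key : ∀ z, exc en S (fun x => if chi en {v} x ≠ 0 then chi en {v} x * τ x else σ' x) {z} =
      exc en (inn en S (W.erase v)) σ' {z} := by
    intro z
    have hTz : ∑ x ∈ T, τ x * (iv {z} v - iv {z} u) = 0 := by
      rw [← Finset.sum_mul, hτ0, zero_mul]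
    have : exc en S (fun x => if chi en {v} x ≠ 0 then chi en {v} x * τ x else σ' x) {z} =
      exc en (inn en S (W.erase v)) σ' {z} + ∑ x ∈ T, τ x * (iv {z} v - iv {z} u) := by
      have e1 : exc en (inn en S (W.erase v)) σ' {z} =
          ∑ x ∈ S, if x ∈ inn en S (W.erase v) then σ' x * chi en {z} x else 0 := by
        unfold exc
        rw [← Finset.sum_filter, Finset.filter_mem_eq_inter,
          Finset.inter_eq_right.2 (show inn en S (W.erase v) ⊆ S from Finset.filter_subset _ _)]
      rw [e1, hT, Finset.sum_filter, ← Finset.sum_add_distrib]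
      unfold exc
      refine Finset.sum_congr rfl fun x hx => ?_
      dsimp only
      by_cases h0 : chi en {v} x = 0
      · rw [if_neg (not_not.2 h0), if_neg (not_not.2 h0), add_zero]
        split_ifs with h1
        · rfl
        · rw [hedge x hx h1 h0, mul_zero]
      · have h1 : x ∉ inn en S (W.erase v) := fun h => h0 (hinn x h)
        rw [if_pos h0, if_pos h0, if_neg h1, zero_add]
        obtain ⟨ε, hε, hf⟩ := hall x hx h0
        have h2 : chi en {v} x = ε := by
          rw [hf]; unfold iv; simp [huv]
        rw [h2, hf {z}]
        rcases hε with rfl | rfl <;> ring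
    rw [this, hTz, add_zero]
  intro z hz
  rw [key]
  by_cases hzv : z = v
  · subst hzv
    have : exc en (inn en S (W.erase z)) σ' {z} = 0 := by
      unfold exc
      exact Finset.sum_eq_zero fun x hx => by rw [hinn x hx, mul_zero]
    rw [this, zero_sub]; exact (dvd_neg).2 hr
  · exact h' z (Finset.mem_erase.2 ⟨hzv, hz⟩)

theorem sol_lift {v u w : V} {x y : E} (hx : x ∈ S) (hy : y ∈ S) (hxy : x ≠ y)
    {ε₁ ε₂ : ℤ} (h₁ : ε₁ = 1 ∨ ε₁ = -1) (h₂ : ε₂ = 1 ∨ ε₂ = -1)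
    (c₁ : ∀ A, chi en A x = ε₁ * (iv A v - iv A u)) (c₂ : ∀ A, chi en A y = ε₂ * (iv A v - iv A w))
    (h : Sol k W (S.erase y) (Function.update en x (u, w)) r) : Sol k W S en r := by
  obtain ⟨σ, hσ, h⟩ := h
  obtain ⟨σ', hσ', h'⟩ := exc_lift en hx hy hxy h₁ h₂ c₁ c₂ hσ
  exact ⟨σ', hσ', fun z hz => by rw [h']; exact h z hz⟩

theorem exempt_case (hk : 0 < k) (hW : 2 ≤ W.card)
    (IH : ∀ (W' : Finset V) (S' : Finset E) (en' : E → V × V) (r' e' q' : V → ℤ) (X' : Set V),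
      W'.card < W.card → Inst k W' S' en' r' e' q' X' → Sol k W' S' en' r')
    {v : V} (hv : v ∈ W) (n : ℕ) :
    ∀ (S : Finset E) (en : E → V × V) (r e q : V → ℤ), S.card = n →
      Inst k W S en r e q {v} → Sol k W S en r := by
  induction n using Nat.strong_induction_on with
  | _ n ih =>
  intro S en r e q hn hI
  rcases slack_or hk IH hI with h | hS
  · exact h
  obtain ⟨u₀, hu₀, hu₀v⟩ : ∃ u ∈ W, u ≠ v := by
    obtain ⟨u, hu, h⟩ := Finset.exists_mem_ne (by omega : 1 < W.card) v
    exact ⟨u, hu, h⟩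
  by_cases hd : dd en S {v} = 0
  · -- isolated
    have hz : ∀ x ∈ S, chi en {v} x = 0 := by
      intro x hx
      have := (Finset.sum_eq_zero_iff_of_nonneg (fun x _ => abs_nonneg (chi en {v} x))).1 hd x hx
      exact abs_eq_zero.1 this
    have h1 := hI.c1 (W \ {v}) Finset.sdiff_subset ⟨u₀, by simp [hu₀, hu₀v]⟩
      (fun h => by
        have h' : v ∈ W \ {v} := by rw [h]; exact hv
        simp at h')
      (by
        rintro x rfl h
        have h' : x ∈ W \ {x} := by rw [h]; exact Finset.mem_singleton_self x
        simp at h')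
    rw [dd_compl (Finset.singleton_subset_iff.2 hv) hI.ends, hd, Finset.sdiff_singleton_eq_erase] at h1
    have h2 := hI.c2
    have h3 : tk k (∑ w ∈ W.erase v, (r w + q w)) = tk k (∑ w ∈ W, q w) := by
      refine tk_congr ?_
      have e1 := Finset.add_sum_erase W (fun w => r w + q w) hv
      have e2 := hI.xz v rfl hv
      have e3 := hI.sum
      rw [Finset.sum_add_distrib (s := W)] at e1
      have : ∑ w ∈ W.erase v, (r w + q w) - ∑ w ∈ W, q w = ∑ w ∈ W, r w - (r v + q v) := by
        linarith
      rw [this]; exact dvd_sub e3 e2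
    have h4 := Finset.add_sum_erase W e hv
    have h5 := hI.qe v hv
    have h6 := abs_nonneg (q v)
    exact ex_remove IH hI hv hu₀ hu₀v (by linarith) fun x hx h => absurd (hz x hx) h
  · obtain ⟨x, hx, hxv⟩ := exists_edge_of_dd hd
    obtain ⟨u, hu, huv, ε, hε, hc⟩ := edge_form (hI.ends x hx) hxv
    by_cases hall : ∀ y ∈ S, chi en {v} y ≠ 0 → ∃ ε : ℤ, (ε = 1 ∨ ε = -1) ∧
      ∀ A, chi en A y = ε * (iv A v - iv A u)
    · by_cases he : e v = 0
      · exact ex_remove IH hI hv hu huv he hall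
      · have hq := hI.qe v hv
        have hp := hI.qp v hv
        have h6 := abs_nonneg (q v)
        have hqq := abs_le.1 hq
        have : ∃ t : ℤ, (t = 1 ∨ t = -1) ∧ |q v - t| ≤ e v - 1 := by
          by_cases h : q v = - e v
          · refine ⟨-1, Or.inr rfl, abs_le.2 ⟨by omega, by omega⟩⟩
          · refine ⟨1, Or.inl rfl, abs_le.2 ⟨by omega, by omega⟩⟩
        obtain ⟨t, ht, hqt⟩ := this
        have hI' := ex_move hI hS hx hε hc hv hu huv ht hqt
        refine sol_del hx ?_ (ih _ ?_ _ _ _ _ _ rfl hI')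
        · rcases ht with rfl | rfl <;> rcases hε with rfl | rfl <;> simp
        · rw [← hn]; exact Finset.card_erase_lt_of_mem hx
    · push Not at hall
      obtain ⟨y, hy, hyv, hyn⟩ := hall
      obtain ⟨w, hw, hwv, ε₂, hε₂, hc₂⟩ := edge_form (hI.ends y hy) hyv
      have huw : u ≠ w := by
        rintro rfl
        obtain ⟨A, hA⟩ := hyn ε₂ hε₂
        exact hA (hc₂ A)
      have hxy : x ≠ y := by
        rintro rfl
        obtain ⟨A, hA⟩ := hyn ε hε
        exact hA (hc A)
      have hI' := ex_lift hI hS hx hy hxy hε hε₂ hc hc₂ hu hw huw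
      refine sol_lift hx hy hxy hε hε₂ hc hc₂ (ih _ ?_ _ _ _ _ _ rfl hI')
      rw [← hn]; exact Finset.card_erase_lt_of_mem hy

end exempt



section nonexempt
variable [DecidableEq V] [DecidableEq E]
variable {k : ℤ} {W : Finset V} {S : Finset E} {en : E → V × V} {r e q : V → ℤ} {X : Set V}

theorem Inst.conn (hk : 2 ≤ k) (hI : Inst k W S en r e q ∅) {A : Finset V} (hA : A ⊆ W)
    (hne : A.Nonempty) (hAW : A ≠ W) : dd en S A ≠ 0 := by
  intro h0
  have h1 := hI.c1 A hA hne hAW (by simp)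
  have hne' : (W \ A).Nonempty := by
    rw [Finset.sdiff_nonempty]; exact fun h => hAW (Finset.Subset.antisymm hA h)
  have h2 := hI.c1 (W \ A) Finset.sdiff_subset hne' (fun h => by
    obtain ⟨a, ha⟩ := hne
    have h' : a ∈ W \ A := by rw [h]; exact hA ha
    exact (Finset.mem_sdiff.1 h').2 ha) (by simp)
  rw [dd_compl hA hI.ends, h0] at h2
  rw [h0] at h1
  have h3 := hI.c2
  have h4 := Finset.sum_sdiff (f := e) hA
  have h5 := Finset.sum_sdiff (f := fun v => r v + q v) hA
  have h6 := tk_add (by omega : 0 < k) (∑ v ∈ W \ A, (r v + q v)) (∑ v ∈ A, (r v + q v))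
  rw [h5, Finset.sum_add_distrib, tk_shift hI.sum] at h6
  linarith

theorem del_step (hk : 0 < k)
    (IS : ∀ (S' : Finset E) (en' : E → V × V) (r' e' q' : V → ℤ),
      S'.card < S.card → Inst k W S' en' r' e' q' ∅ → Sol k W S' en' r')
    (hI : Inst k W S en r e q ∅) (hS : Slk k W S en r e q)
    {v u : V} (huv : u ≠ v) {x : E} (hx : x ∈ S) {ε : ℤ} (hε : ε = 1 ∨ ε = -1)
    (c : ∀ A, chi en A x = ε * (iv A v - iv A u))
    {t : ℤ} (ht : t = 1 ∨ t = -1)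
    (hv : 2 * k - 2 + tk k (r v + q v - t) ≤ dd en S {v} - 1 + e v)
    (hu : 2 * k - 2 + tk k (r u + q u + t) ≤ dd en S {u} - 1 + e u) : Sol k W S en r := by
  have hs : t * ε = 1 ∨ t * ε = -1 := by
    rcases ht with rfl | rfl <;> rcases hε with rfl | rfl <;> simp
  refine sol_del hx hs (IS _ _ _ e q (Finset.card_erase_lt_of_mem hx) ?_)
  have hd := dd_erase en hx
  have hp : ∀ A : Finset V, ∑ w ∈ A, (r w - t * ε * chi en {w} x + q w) =
      ∑ w ∈ A, (r w + q w) + (- (t * ε * chi en A x)) := by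
    intro A
    rw [← sum_chi (en := en) A x, Finset.mul_sum, ← Finset.sum_neg_distrib, ← Finset.sum_add_distrib]
    exact Finset.sum_congr rfl fun w _ => by ring
  refine ⟨fun z hz => hI.ends z (Finset.mem_of_mem_erase hz), fun z hz => ?_, ?_, hI.qe, hI.qp,
    hI.xs, by simp, ?_, hI.c2⟩
  · rw [hd]
    have h1 := hI.par z hz
    have h2 := two_dvd_abs_sub (chi en {z} x)
    rcases hs with h | h <;> rw [h] <;> omega
  · rw [Finset.sum_sub_distrib, ← Finset.mul_sum, sum_chi, chi_W en (hI.ends x hx)]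
    simpa using hI.sum
  · intro A hA hne hAW _
    rw [hp, hd]
    by_cases hA2 : 2 ≤ A.card
    · have h1 := hS A hA hA2 hAW
      have h2 := tk_add_abs hk (∑ w ∈ A, (r w + q w)) (- (t * ε * chi en A x))
      rw [abs_neg, abs_pm_mul hs] at h2
      have h3 : |chi en A x| ≤ 1 := by
        rcases chi_cases en A x with h | h | h <;> simp [h]
      linarith
    · have : A.card = 1 := by
        have := Finset.card_pos.2 hne
        omega
      obtain ⟨z, rfl⟩ := Finset.card_eq_one.1 this
      have h1 := hI.c1 {z} hA hne hAW (by simp)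
      rw [Finset.sum_singleton, Finset.sum_singleton] at *
      rw [c, abs_pm_mul hε, iv_single, iv_single]
      by_cases hzv : v = z
      · subst hzv
        rw [if_pos rfl, if_neg huv]
        have e1 : r v + q v + -(t * ε * (ε * (1 - 0))) = r v + q v - t := by
          rcases hε with rfl | rfl <;> ring
        rw [e1]; norm_num; linarith
      · rw [if_neg hzv]
        by_cases hzu : u = z
        · subst hzu
          rw [if_pos rfl]
          have e1 : r u + q u + -(t * ε * (ε * (0 - 1))) = r u + q u + t := by
            rcases hε with rfl | rfl <;> ring
          rw [e1]; norm_num; linarith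
        · rw [if_neg hzu]; simpa using h1

/-- the bumped inequality -/
theorem bump_ineq (hk : 0 < k) {c j t : ℤ} (hj : 0 ≤ j) (ht : t = 1 ∨ t = -1) {y : V}
    {A : Finset V} (h : c + tk k (∑ v ∈ A, (r v + q v)) ≤ dd en S A + ∑ v ∈ A, e v) :
    c + tk k (∑ v ∈ A, (r v + (q v + t * j * iv {y} v))) ≤
      dd en S A + ∑ v ∈ A, (e v + j * iv {y} v) := by
  have e1 : ∑ v ∈ A, (r v + (q v + t * j * iv {y} v)) =
      ∑ v ∈ A, (r v + q v) + t * j * iv A y := by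
    rw [← sum_iv A y, Finset.mul_sum, ← Finset.sum_add_distrib]
    exact Finset.sum_congr rfl fun w _ => by ring
  have e2 : ∑ v ∈ A, (e v + j * iv {y} v) = ∑ v ∈ A, e v + j * iv A y := by
    rw [← sum_iv A y, Finset.mul_sum, ← Finset.sum_add_distrib]
  rw [e1, e2]
  have h1 := tk_add_abs hk (∑ v ∈ A, (r v + q v)) (t * j * iv A y)
  have h2 : |t * j * iv A y| = j * iv A y := by
    rw [mul_assoc, abs_pm_mul ht, abs_of_nonneg]
    rcases iv_cases A y with h | h <;> rw [h.2] <;> simp [hj]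
  linarith

theorem Inst.bump (hk : 0 < k) (hI : Inst k W S en r e q ∅) {j t : ℤ} (hj : 0 ≤ j)
    (ht : t = 1 ∨ t = -1) {y : V} (hy : y ∈ W)
    (hc2 : ∑ v ∈ W, e v + j ≤ 2 * k - 2 + tk k (∑ v ∈ W, q v + t * j))
    (hX : X.Subsingleton)
    (hz : ∀ v ∈ X, v ∈ W → 2 * k ∣ r v + (q v + t * j * iv {y} v)) :
    Inst k W S en r (fun v => e v + j * iv {y} v) (fun v => q v + t * j * iv {y} v) X := by
  refine ⟨hI.ends, hI.par, hI.sum, fun v hv => ?_, fun v hv => ?_, hX, hz,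
    fun A hA hne hAW _ => bump_ineq hk hj ht (hI.c1 A hA hne hAW (by simp)), ?_⟩
  · refine (abs_add_le _ _).trans (add_le_add (hI.qe v hv) ?_)
    rw [mul_assoc, abs_pm_mul ht, abs_of_nonneg]
    rcases iv_cases {y} v with h | h <;> rw [h.2] <;> simp [hj]
  · have := hI.qp v hv
    rcases ht with rfl | rfl
    · have e1 : e v + j * iv {y} v - (q v + 1 * j * iv {y} v) = e v - q v := by ring
      rw [e1]; exact this
    · have h2 := dvd_add this (Dvd.intro (j * iv {y} v) rfl : (2:ℤ) ∣ 2 * (j * iv {y} v))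
      have e1 : e v + j * iv {y} v - (q v + -1 * j * iv {y} v) =
        e v - q v + 2 * (j * iv {y} v) := by ring
      rw [e1]; exact h2
  · rw [Finset.sum_add_distrib, Finset.sum_add_distrib, ← Finset.mul_sum, ← Finset.mul_sum, sum_iv]
    have : iv W y = 1 := by unfold iv; simp [hy]
    rw [this, mul_one, mul_one]; exact hc2

theorem allpos (hk : 2 ≤ k) (hW : 2 ≤ W.card)
    (IS : ∀ (S' : Finset E) (en' : E → V × V) (r' e' q' : V → ℤ),
      S'.card < S.card → Inst k W S' en' r' e' q' ∅ → Sol k W S' en' r')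
    (hEx : ∀ v ∈ W, ∀ (S' : Finset E) (en' : E → V × V) (r' e' q' : V → ℤ),
      Inst k W S' en' r' e' q' {v} → Sol k W S' en' r')
    (hI : Inst k W S en r e q ∅) (hS : Slk k W S en r e q)
    (hpos : ∀ v ∈ W, tk k (r v + q v - 1) = tk k (r v + q v) - 1)
    (hq : ∀ v ∈ W, q v = - e v)
    (hti : ∀ v ∈ W, dd en S {v} + e v = 2 * k - 2 + tk k (r v + q v)) : Sol k W S en r := by
  have hk0 : 0 < k := by omega
  set D := ∑ v ∈ W, e v with hD
  have hQ : ∑ v ∈ W, q v = - D := by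
    rw [hD, ← Finset.sum_neg_distrib]; exact Finset.sum_congr rfl hq
  have hc2 := hI.c2
  rw [hQ, tk_neg hk0, ← hD] at hc2
  have hD0 : 0 ≤ D := Finset.sum_nonneg fun v hv => (abs_nonneg _).trans (hI.qe v hv)
  have hD1 : D ≤ 2 * k - 1 := by
    by_contra hc
    have h1 := tk_le hk0 D 1
    rw [abs_of_nonneg (by linarith)] at h1
    linarith
  have htpos : ∀ v ∈ W, 1 ≤ tk k (r v + q v) := fun v hv => by
    have h1 := tk_nonneg hk0 (r v + q v - 1)
    rw [hpos v hv] at h1; linarith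
  by_cases h6 : ∃ y ∈ W, D + tk k (r y + q y) ≤ 2 * k - 1
  · obtain ⟨y, hy, h6⟩ := h6
    have h1 := htpos y hy
    refine hEx y hy S en r _ _ (hI.bump hk0 (j := tk k (r y + q y)) (t := -1) (y := y) (by linarith)
      (Or.inr rfl) hy ?_ (Set.subsingleton_singleton) ?_)
    · rw [hQ, ← hD]
      have e1 : -D + -1 * tk k (r y + q y) = - (D + tk k (r y + q y)) := by ring
      rw [e1, tk_neg hk0, tk_of_range (x := D + tk k (r y + q y)) hk0 (by linarith) (by linarith)]
      rcases min_cases (D + tk k (r y + q y)) (2 * k - (D + tk k (r y + q y))) with h | h <;>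
        rw [h.1] <;> linarith
    · rintro v rfl _
      have h2 := tk_pos hk0 (hpos v hy)
      have : iv {v} v = 1 := by unfold iv; simp
      rw [this]
      convert h2 using 1; ring
  · push Not at h6
    obtain ⟨y, hy⟩ : W.Nonempty := Finset.card_pos.1 (by omega)
    have h6y := h6 y hy
    have h7 := tk_le_k k (r y + q y)
    have h8 := htpos y hy
    set τ := tk k (r y + q y) with hτ
    have hyy : iv {y} y = 1 := by unfold iv; simp
    have hI' := hI.bump hk0 (X := ∅) (j := k - τ) (t := 1) (y := y) (by linarith)
      (Or.inl rfl) hy (by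
        rw [hQ, ← hD]
        have e1 : -D + 1 * (k - τ) = - (D - (k - τ)) := by ring
        rw [e1, tk_neg hk0, tk_of_range hk0 (by linarith) (by linarith)]
        rcases min_cases (D - (k - τ)) (2 * k - (D - (k - τ))) with h | h <;>
          rw [h.1] <;> linarith) Set.subsingleton_empty (by simp)
    have hS' : Slk k W S en r (fun v => e v + (k - τ) * iv {y} v)
        (fun v => q v + 1 * (k - τ) * iv {y} v) := fun A hA hA2 hAW =>
      bump_ineq hk0 (by linarith) (Or.inl rfl) (hS A hA hA2 hAW)
    have hyW : ({y} : Finset V) ≠ W := fun h => by rw [← h] at hW; simp at hW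
    obtain ⟨x, hx, hxy⟩ := exists_edge_of_dd
      (hI.conn hk (Finset.singleton_subset_iff.2 hy) (Finset.singleton_nonempty y) hyW)
    obtain ⟨w, hw, hwy, ε, hε, hc⟩ := edge_form (hI.ends x hx) hxy
    refine del_step hk0 IS hI' hS' hwy hx hε hc (t := -1) (Or.inr rfl) ?_ ?_
    · have h2 := tk_pos hk0 (hpos y hy)
      have h3 := hti y hy
      rw [hyy]
      have e1 : tk k (r y + (q y + 1 * (k - τ) * 1) - -1) = tk k (k + 1) := by
        refine tk_congr ?_
        convert h2 using 1; ring
      rw [e1, tk_of_range hk0 (by linarith) (by linarith), min_eq_right (by linarith)]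
      linarith
    · have h3 := hti w hw
      have h4 := hpos w hw
      have hwy' : iv {y} w = 0 := by rw [iv_single, if_neg hwy]
      rw [hwy', mul_zero, mul_zero, add_zero, add_zero, ← sub_eq_add_neg, h4]
      linarith

theorem Inst.neg (hk : 0 < k) (hI : Inst k W S en r e q ∅) :
    Inst k W S en (fun v => - r v) e (fun v => - q v) ∅ := by
  refine ⟨hI.ends, fun v hv => ?_, ?_, fun v hv => ?_, fun v hv => ?_, hI.xs, by simp, ?_, ?_⟩
  · have := hI.par v hv; omega
  · rw [Finset.sum_neg_distrib]; exact (dvd_neg).2 hI.sum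
  · rw [abs_neg]; exact hI.qe v hv
  · have := hI.qp v hv; omega
  · intro A hA hne hAW hX
    have : ∑ v ∈ A, (- r v + - q v) = - ∑ v ∈ A, (r v + q v) := by
      rw [← Finset.sum_neg_distrib]; exact Finset.sum_congr rfl fun _ _ => by ring
    rw [this, tk_neg hk]; exact hI.c1 A hA hne hAW (by simp)
  · rw [Finset.sum_neg_distrib, tk_neg hk]; exact hI.c2

theorem Slk.neg (hk : 0 < k) (hS : Slk k W S en r e q) :
    Slk k W S en (fun v => - r v) e (fun v => - q v) := by
  intro A hA h2 hAW
  have : ∑ v ∈ A, (- r v + - q v) = - ∑ v ∈ A, (r v + q v) := by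
    rw [← Finset.sum_neg_distrib]; exact Finset.sum_congr rfl fun _ _ => by ring
  rw [this, tk_neg hk]; exact hS A hA h2 hAW

/-- dropping a beneficial pre-oriented edge -/
theorem drop_step (hk : 0 < k) (hI : Inst k W S en r e q ∅) (hS : Slk k W S en r e q)
    {v : V} (hv : v ∈ W) {t : ℤ} (ht : t = 1 ∨ t = -1)
    (hp : tk k (r v + q v - t) = tk k (r v + q v) - 1) (hq : |q v - t| ≤ e v - 1) :
    Inst k W S en r (fun w => e w - iv {v} w) (fun w => q w - t * iv {v} w) ∅ := by
  have hse : ∀ A : Finset V, ∑ w ∈ A, (e w - iv {v} w) = ∑ w ∈ A, e w - iv A v := by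
    intro A; rw [Finset.sum_sub_distrib, sum_iv]
  refine ⟨hI.ends, hI.par, hI.sum, fun w hw => ?_, fun w hw => ?_, hI.xs, by simp, ?_, ?_⟩
  · rw [iv_single]
    split_ifs with h
    · rw [h]; simpa using hq
    · simpa using hI.qe w hw
  · have := hI.qp w hw
    rcases ht with rfl | rfl <;> omega
  · intro A hA hne hAW _
    have e1 : ∑ w ∈ A, (r w + (q w - t * iv {v} w)) = ∑ w ∈ A, (r w + q w) + -(t * iv A v) := by
      rw [← sum_iv A v, Finset.mul_sum, ← Finset.sum_neg_distrib, ← Finset.sum_add_distrib]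
      exact Finset.sum_congr rfl fun w _ => by ring
    rw [e1, hse]
    have h1 := hI.c1 A hA hne hAW (by simp)
    rcases iv_cases A v with h | h <;> rw [h.2]
    · by_cases hA1 : A = {v}
      · subst hA1
        rw [Finset.sum_singleton, Finset.sum_singleton] at *
        have e2 : r v + q v + -(t * 1) = r v + q v - t := by ring
        rw [e2, hp]; linarith
      · have h2 := hS A hA (card_two_of_ne h.1 hA1) hAW
        have h3 := tk_add_abs hk (∑ w ∈ A, (r w + q w)) (-(t * 1))
        have h4 : |-(t * 1)| = 1 := by rcases ht with rfl | rfl <;> simp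
        linarith
    · simpa using h1
  · rw [hse, Finset.sum_sub_distrib, ← Finset.mul_sum, sum_iv]
    have : iv W v = 1 := by unfold iv; simp [hv]
    rw [this, mul_one]
    have h3 := tk_add_abs hk (∑ w ∈ W, q w - t) t
    have h4 : |t| = 1 := by rcases ht with rfl | rfl <;> simp
    have h5 := hI.c2
    rw [sub_add_cancel] at h3
    linarith

theorem nonexempt_case (hk : 2 ≤ k) (hW : 2 ≤ W.card)
    (IH : ∀ (W' : Finset V) (S' : Finset E) (en' : E → V × V) (r' e' q' : V → ℤ) (X' : Set V),
      W'.card < W.card → Inst k W' S' en' r' e' q' X' → Sol k W' S' en' r')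
    (n : ℕ) : ∀ (m : ℕ) (S : Finset E) (en : E → V × V) (r e q : V → ℤ), S.card = n →
      ∑ v ∈ W, e v = m → Inst k W S en r e q ∅ → Sol k W S en r := by
  have hk0 : 0 < k := by omega
  have hEx : ∀ v ∈ W, ∀ (S' : Finset E) (en' : E → V × V) (r' e' q' : V → ℤ),
      Inst k W S' en' r' e' q' {v} → Sol k W S' en' r' := fun v hv S' en' r' e' q' h =>
    exempt_case hk0 hW IH hv _ S' en' r' e' q' rfl h
  induction n using Nat.strong_induction_on with
  | _ n ihn =>
  intro m
  induction m using Nat.strong_induction_on with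
  | _ m ihm =>
  intro S en r e q hn hm hI
  have IS : ∀ (S' : Finset E) (en' : E → V × V) (r' e' q' : V → ℤ),
      S'.card < S.card → Inst k W S' en' r' e' q' ∅ → Sol k W S' en' r' := by
    intro S' en' r' e' q' hlt h
    have h0 : 0 ≤ ∑ v ∈ W, e' v :=
      Finset.sum_nonneg fun v hv => (abs_nonneg _).trans (h.qe v hv)
    exact ihn _ (by omega) (∑ v ∈ W, e' v).toNat S' en' r' e' q' rfl
      (Int.toNat_of_nonneg h0).symm h
  rcases slack_or hk0 IH hI with h | hS
  · exact h
  by_cases hz : ∃ v ∈ W, tk k (r v + q v) = 0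
  · obtain ⟨v, hv, hz⟩ := hz
    rw [tk_eq_zero hk0] at hz
    refine hEx v hv S en r e q (hI.mono Set.subsingleton_singleton ?_ (by simp))
    rintro w rfl _; exact hz
  push Not at hz
  have hpn : ∀ v ∈ W, tk k (r v + q v - 1) = tk k (r v + q v) - 1 ∨
      tk k (r v + q v + 1) = tk k (r v + q v) - 1 := fun v hv => tk_step hk0 (hz v hv)
  have hsW : ∀ v : V, ({v} : Finset V) ≠ W := fun v h => by rw [← h] at hW; simp at hW
  have hc1 : ∀ v ∈ W, 2 * k - 2 + tk k (r v + q v) ≤ dd en S {v} + e v := by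
    intro v hv
    simpa using hI.c1 {v} (Finset.singleton_subset_iff.2 hv) (Finset.singleton_nonempty v) (hsW v)
      (by simp)
  by_cases hsur : ∃ v ∈ W, 2 * k + tk k (r v + q v) ≤ dd en S {v} + e v
  · obtain ⟨v, hv, hsur⟩ := hsur
    obtain ⟨x, hx, hxv⟩ := exists_edge_of_dd
      (hI.conn hk (Finset.singleton_subset_iff.2 hv) (Finset.singleton_nonempty v) (hsW v))
    obtain ⟨y, hy, hyv, ε, hε, hc⟩ := edge_form (hI.ends x hx) hxv
    have h1 := hc1 y hy
    rcases hpn y hy with h | h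
    · refine del_step hk0 IS hI hS hyv hx hε hc (t := -1) (Or.inr rfl) ?_ ?_
      · have h3 := tk_add_abs hk0 (r v + q v) (- -1)
        rw [← sub_eq_add_neg] at h3
        norm_num at h3 ⊢
        linarith
      · rw [← sub_eq_add_neg, h]; linarith
    · refine del_step hk0 IS hI hS hyv hx hε hc (t := 1) (Or.inl rfl) ?_ ?_
      · have h3 := tk_add_abs hk0 (r v + q v) (-1)
        rw [← sub_eq_add_neg] at h3
        norm_num at h3 ⊢
        linarith
      · rw [h]; linarith
  push Not at hsur
  have hti : ∀ v ∈ W, dd en S {v} + e v = 2 * k - 2 + tk k (r v + q v) := by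
    intro v hv
    have h1 := hc1 v hv
    have h2 := hsur v hv
    have h3 := hI.parA hk0 (Finset.singleton_subset_iff.2 hv)
    rw [Finset.sum_singleton, Finset.sum_singleton] at h3
    omega
  have hdrop : ∀ v ∈ W, ∀ t : ℤ, (t = 1 ∨ t = -1) →
      tk k (r v + q v - t) = tk k (r v + q v) - 1 → |q v - t| ≤ e v - 1 → Sol k W S en r := by
    intro v hv t ht hp hq
    have hI' := drop_step hk0 hI hS hv ht hp hq
    have hsum : ∑ w ∈ W, (e w - iv {v} w) = m - 1 := by
      rw [Finset.sum_sub_distrib, sum_iv, hm]; unfold iv; simp [hv]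
    have h0 : 0 ≤ ∑ w ∈ W, (e w - iv {v} w) :=
      Finset.sum_nonneg fun v hv => (abs_nonneg _).trans (hI'.qe v hv)
    exact ihm (m - 1) (by omega) S en r _ _ hn (by rw [hsum]; omega) hI'
  by_cases hd1 : ∃ v ∈ W, tk k (r v + q v - 1) = tk k (r v + q v) - 1 ∧ q v ≠ - e v
  · obtain ⟨v, hv, hp, hq⟩ := hd1
    refine hdrop v hv 1 (Or.inl rfl) hp ?_
    have h1 := abs_le.1 (hI.qe v hv)
    have h2 := hI.qp v hv
    exact abs_le.2 ⟨by omega, by omega⟩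
  by_cases hd2 : ∃ v ∈ W, tk k (r v + q v + 1) = tk k (r v + q v) - 1 ∧ q v ≠ e v
  · obtain ⟨v, hv, hp, hq⟩ := hd2
    refine hdrop v hv (-1) (Or.inr rfl) (by rw [sub_neg_eq_add]; exact hp) ?_
    have h1 := abs_le.1 (hI.qe v hv)
    have h2 := hI.qp v hv
    exact abs_le.2 ⟨by omega, by omega⟩
  push Not at hd1 hd2
  set U := W.filter fun v => tk k (r v + q v - 1) = tk k (r v + q v) - 1 with hU
  by_cases hUW : U = W
  · have hpos : ∀ v ∈ W, tk k (r v + q v - 1) = tk k (r v + q v) - 1 := fun v hv => by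
      rw [← hUW] at hv; exact (Finset.mem_filter.1 hv).2
    exact allpos hk hW IS hEx hI hS hpos (fun v hv => hd1 v hv (hpos v hv)) hti
  by_cases hU0 : U.Nonempty
  · obtain ⟨x, hx, hxU⟩ := exists_edge_of_dd (hI.conn hk (Finset.filter_subset _ _) hU0 hUW)
    obtain ⟨v, hv, u, hu, hvU, huU, ε, hε, hc⟩ := edge_form_cut (hI.ends x hx) hxU
    have h1 := (Finset.mem_filter.1 hvU).2
    have h2 : tk k (r u + q u + 1) = tk k (r u + q u) - 1 := by
      rcases hpn u hu with h | h
      · exact absurd (Finset.mem_filter.2 ⟨hu, h⟩) huU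
      · exact h
    have hne : u ≠ v := by rintro rfl; exact huU hvU
    have h3 := hc1 v hv
    have h4 := hc1 u hu
    refine del_step hk0 IS hI hS hne hx hε hc (t := 1) (Or.inl rfl) ?_ ?_
    · rw [h1]; linarith
    · rw [h2]; linarith
  · rw [Finset.not_nonempty_iff_eq_empty] at hU0
    have hneg : ∀ v ∈ W, tk k (r v + q v + 1) = tk k (r v + q v) - 1 := by
      intro v hv
      rcases hpn v hv with h | h
      · have : v ∈ U := Finset.mem_filter.2 ⟨hv, h⟩
        rw [hU0] at this; simp at this
      · exact h
    have hn1 : ∀ v, tk k (- r v + - q v) = tk k (r v + q v) := fun v => by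
      rw [← tk_neg hk0]; congr 1; ring
    refine sol_neg (allpos hk hW IS hEx (hI.neg hk0) (hS.neg hk0) ?_ ?_ ?_)
    · intro v hv
      have e1 : tk k (- r v + - q v - 1) = tk k (r v + q v + 1) := by
        rw [← tk_neg hk0]; congr 1; ring
      rw [hn1, e1]; exact hneg v hv
    · intro v hv
      rw [hd2 v hv (hneg v hv)]
    · intro v hv
      rw [hn1]; exact hti v hv

theorem stepI (hk : 2 ≤ k) (n : ℕ) : ∀ (W : Finset V) (S : Finset E) (en : E → V × V)
    (r e q : V → ℤ) (X : Set V), W.card = n → Inst k W S en r e q X → Sol k W S en r := by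
  have hk0 : 0 < k := by omega
  induction n using Nat.strong_induction_on with
  | _ n ih =>
  intro W S en r e q X hn hI
  by_cases hW : W.card ≤ 1
  · exact base hI hW
  have hW2 : 2 ≤ W.card := by omega
  have IH : ∀ (W' : Finset V) (S' : Finset E) (en' : E → V × V) (r' e' q' : V → ℤ) (X' : Set V),
      W'.card < W.card → Inst k W' S' en' r' e' q' X' → Sol k W' S' en' r' :=
    fun W' S' en' r' e' q' X' hlt h => ih _ (by omega) W' S' en' r' e' q' X' rfl h
  by_cases hX : ∃ v ∈ X, v ∈ W
  · obtain ⟨v, hvX, hv⟩ := hX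
    refine exempt_case hk0 hW2 IH hv _ S en r e q rfl (hI.mono Set.subsingleton_singleton ?_ ?_)
    · rintro w rfl _; exact hI.xz w hvX hv
    · intro x hx _; exact hI.xs hx hvX
  · push Not at hX
    have h0 : 0 ≤ ∑ v ∈ W, e v :=
      Finset.sum_nonneg fun v hv => (abs_nonneg _).trans (hI.qe v hv)
    exact nonexempt_case hk hW2 IH _ (∑ v ∈ W, e v).toNat S en r e q rfl
      (Int.toNat_of_nonneg h0).symm
      (hI.mono Set.subsingleton_empty (by simp) fun x hx hxW => absurd hxW (hX x hx))

end nonexempt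



/-! ### The orientation with all excesses in `{0, k, -k}` -/

section phaseOne
variable [DecidableEq V] [DecidableEq E]

structure Ph (k : ℤ) (W : Finset V) (S : Finset E) (en : E → V × V) (f : V → ℤ) : Prop where
  ends : ∀ x ∈ S, (en x).1 ∈ W ∧ (en x).2 ∈ W
  f01 : ∀ v ∈ W, f v = 0 ∨ f v = 1
  fs : 2 ∣ ∑ v ∈ W, f v
  ev : ∀ v ∈ W, 2 ∣ dd en S {v}
  odd : ∀ A ⊆ W, ¬ 2 ∣ ∑ v ∈ A, f v → 3 * k - 2 ≤ dd en S A

def SolP (k : ℤ) (W : Finset V) (S : Finset E) (en : E → V × V) (f : V → ℤ) : Prop :=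
  ∃ σ : E → ℤ, PM σ ∧ ∀ v ∈ W, (f v = 0 → exc en S σ {v} = 0) ∧
    (f v = 1 → exc en S σ {v} = k ∨ exc en S σ {v} = -k)

variable {k : ℤ} {W : Finset V} {S : Finset E} {en : E → V × V} {f : V → ℤ}

theorem Ph.evA (h : Ph k W S en f) {A : Finset V} (hA : A ⊆ W) : 2 ∣ dd en S A := by
  have h1 := dd_par_sum en S A
  have h2 : 2 ∣ ∑ v ∈ A, dd en S {v} := Finset.dvd_sum fun v hv => h.ev v (hA hv)
  omega

theorem exc_cut (σ : E → ℤ) (A : Finset V) :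
    exc en S σ A = ∑ v ∈ A, ∑ x ∈ cutE en S A, σ x * chi en {v} x := by
  rw [Finset.sum_comm]
  have h2 : exc en S σ A = ∑ x ∈ cutE en S A, σ x * chi en A x := by
    unfold exc cutE
    rw [Finset.sum_filter]
    refine Finset.sum_congr rfl fun x _ => ?_
    split_ifs with h
    · rfl
    · rw [not_not.1 h, mul_zero]
  rw [h2]
  refine Finset.sum_congr rfl fun x _ => ?_
  rw [chi_sum, Finset.mul_sum]

theorem dd_cut (A : Finset V) :
    dd en S A = ∑ v ∈ A, ∑ x ∈ cutE en S A, |chi en {v} x| := by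
  rw [← cut_abs_sum en S subset_rfl]
  unfold dd cutE
  rw [Finset.sum_filter]
  refine Finset.sum_congr rfl fun x _ => ?_
  split_ifs with h
  · rfl
  · rw [not_not.1 h, abs_zero]

theorem uncross_cap (A B : Finset V) :
    dd en S (A ∩ B) + dd en S (A ∪ B) ≤ dd en S A + dd en S B := by
  unfold dd
  rw [← Finset.sum_add_distrib, ← Finset.sum_add_distrib]
  refine Finset.sum_le_sum fun x _ => ?_
  unfold chi iv
  by_cases a : (en x).1 ∈ A <;> by_cases b : (en x).1 ∈ B <;> by_cases c : (en x).2 ∈ A <;>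
    by_cases d : (en x).2 ∈ B <;> simp [a, b, c, d]

theorem uncross_diff {A B : Finset V} {x : E} (hx : x ∈ S) {u v : V} {ε : ℤ} (hε : ε = 1 ∨ ε = -1)
    (c : ∀ A, chi en A x = ε * (iv A v - iv A u)) (huA : u ∈ A) (huB : u ∈ B) (hvA : v ∉ A)
    (hvB : v ∉ B) : dd en S (A \ B) + dd en S (B \ A) + 2 ≤ dd en S A + dd en S B := by
  unfold dd
  have hnn : ∀ y ∈ S, 0 ≤ |chi en A y| + |chi en B y| - (|chi en (A \ B) y| + |chi en (B \ A) y|) := by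
    intro y _
    unfold chi iv
    by_cases a : (en y).1 ∈ A <;> by_cases b : (en y).1 ∈ B <;> by_cases c : (en y).2 ∈ A <;>
      by_cases d : (en y).2 ∈ B <;> simp [a, b, c, d]
  have h1 := Finset.single_le_sum hnn hx
  rw [Finset.sum_sub_distrib, Finset.sum_add_distrib, Finset.sum_add_distrib] at h1
  have h2 : |chi en A x| + |chi en B x| - (|chi en (A \ B) x| + |chi en (B \ A) x|) = 2 := by
    simp only [c, abs_pm_mul hε]
    unfold iv
    simp [huA, huB, hvA, hvB]
  linarith

theorem Ph.split (hk : 2 ≤ k) (hk2 : 2 ∣ k) (h : Ph k W S en f) {v : V} (hv : v ∈ W)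
    (hd0 : dd en S {v} ≠ 0) (hd : f v = 1 → 3 * k ≤ dd en S {v}) :
    ∃ x ∈ S, ∃ y ∈ S, x ≠ y ∧ ∃ u w : V, ∃ ε₁ ε₂ : ℤ, (ε₁ = 1 ∨ ε₁ = -1) ∧ (ε₂ = 1 ∨ ε₂ = -1) ∧
      (∀ A, chi en A x = ε₁ * (iv A v - iv A u)) ∧ (∀ A, chi en A y = ε₂ * (iv A v - iv A w)) ∧
      Ph k W (S.erase y) (Function.update en x (u, w)) f := by
  obtain ⟨x, hx, hxv⟩ := exists_edge_of_dd hd0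
  obtain ⟨u, hu, huv, ε₁, h₁, c₁⟩ := edge_form (h.ends x hx) hxv
  -- main claim
  have main : ∃ y ∈ S, x ≠ y ∧ chi en {v} y ≠ 0 ∧ ∀ w ε₂, (ε₂ = 1 ∨ ε₂ = -1) →
      (∀ A, chi en A y = ε₂ * (iv A v - iv A w)) →
      ∀ A ⊆ W, v ∉ A → u ∈ A → w ∈ A → ¬ 2 ∣ ∑ z ∈ A, f z → ¬ dd en S A ≤ 3 * k - 2 := by
    classical
    set F := W.powerset.filter fun A => v ∉ A ∧ u ∈ A ∧ ¬ 2 ∣ ∑ z ∈ A, f z ∧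
      dd en S A ≤ 3 * k - 2 with hF
    have hun : ∀ A ∈ F, ∀ B ∈ F, A ∪ B ∈ F := by
      intro A hA B hB
      obtain ⟨hAW, hvA, huA, hoA, hdA⟩ := Finset.mem_filter.1 hA
      obtain ⟨hBW, hvB, huB, hoB, hdB⟩ := Finset.mem_filter.1 hB
      rw [Finset.mem_powerset] at hAW hBW
      have hABW := Finset.union_subset hAW hBW
      have hs := Finset.sum_union_inter (s₁ := A) (s₂ := B) (f := f)
      refine Finset.mem_filter.2 ⟨Finset.mem_powerset.2 hABW, by simp [hvA, hvB],
        by simp [huA], ?_⟩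
      by_cases ho : 2 ∣ ∑ z ∈ A ∩ B, f z
      · exfalso
        have e1 := Finset.sum_inter_add_sum_sdiff A B f
        have e2 := Finset.sum_inter_add_sum_sdiff B A f
        rw [Finset.inter_comm] at e2
        have o1 := h.odd (A \ B) (Finset.sdiff_subset.trans hAW) (by omega)
        have o2 := h.odd (B \ A) (Finset.sdiff_subset.trans hBW) (by omega)
        have := uncross_diff hx h₁ c₁ huA huB hvA hvB
        omega
      · have o1 := h.odd (A ∩ B) (Finset.inter_subset_left.trans hAW) ho
        have := uncross_cap (en := en) (S := S) A B
        exact ⟨by omega, by omega⟩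
    by_cases hF0 : F.Nonempty
    · obtain ⟨M, hM, hmax⟩ := Finset.exists_max_image F Finset.card hF0
      have hsub : ∀ A ∈ F, A ⊆ M := by
        intro A hA
        have h1 := hmax _ (hun M hM A hA)
        have h2 := Finset.eq_of_subset_of_card_le Finset.subset_union_left h1
        rw [h2]; exact Finset.subset_union_right
      obtain ⟨hMW, hvM, huM, hoM, hdM⟩ := Finset.mem_filter.1 hM
      rw [Finset.mem_powerset] at hMW
      have hex : ∃ y ∈ S, chi en {v} y ≠ 0 ∧ chi en M y = 0 := by
        by_contra hc
        push Not at hc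
        have hdd : dd en S (insert v M) = dd en S M - dd en S {v} := by
          unfold dd
          rw [← Finset.sum_sub_distrib]
          refine Finset.sum_congr rfl fun y hy => ?_
          have e1 : chi en (insert v M) y = chi en {v} y + chi en M y := by
            rw [chi_sum, Finset.sum_insert hvM, ← chi_sum]
          rw [e1]
          by_cases h0 : chi en {v} y = 0
          · rw [h0]; simp
          · obtain ⟨w, hw, hwv, ε, hε, hc'⟩ := edge_form (h.ends y hy) h0
            have h2 := hc y hy h0
            rw [hc'] at h2 ⊢
            rw [hc' M]
            rcases iv_cases M v with a | a
            · exact absurd a.1 hvM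
            rcases iv_cases M w with b | b
            · rw [a.2, b.2, iv_single, iv_single, if_pos rfl, if_neg hwv]
              rcases hε with rfl | rfl <;> norm_num
            · rw [a.2, b.2] at h2; simp at h2
        rcases h.f01 v hv with h0 | h1
        · have := h.odd (insert v M) (Finset.insert_subset hv hMW) (by
            rw [Finset.sum_insert hvM, h0, zero_add]; exact hoM)
          have h3 := dd_nonneg en S {v}
          omega
        · have := hd h1
          have h3 := dd_nonneg en S (insert v M)
          omega
      obtain ⟨y, hy, hyv, hyM⟩ := hex
      have hiv : iv M v = 0 := by unfold iv; simp [hvM]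
      have hiu : iv M u = 1 := by unfold iv; simp [huM]
      refine ⟨y, hy, ?_, hyv, ?_⟩
      · rintro rfl
        rw [c₁, hiv, hiu] at hyM
        rcases h₁ with rfl | rfl <;> simp at hyM
      · intro w ε₂ h₂ c₂ A hA hvA huA hwA hoA hdA
        have hAF : A ∈ F := Finset.mem_filter.2 ⟨Finset.mem_powerset.2 hA, hvA, huA, hoA, hdA⟩
        have hwM := hsub A hAF hwA
        have hiw : iv M w = 1 := by unfold iv; simp [hwM]
        rw [c₂, hiv, hiw] at hyM
        rcases h₂ with rfl | rfl <;> simp at hyM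
    · have : ∃ y ∈ S, x ≠ y ∧ chi en {v} y ≠ 0 := by
        by_contra hc
        push Not at hc
        have h1 : dd en S {v} = |chi en {v} x| := by
          unfold dd
          refine Finset.sum_eq_single_of_mem x hx fun y hy hyx => ?_
          rw [hc y hy (Ne.symm hyx), abs_zero]
        have h2 := h.ev v hv
        rcases chi_cases en {v} x with h3 | h3 | h3
        · exact hxv h3
        · rw [h1, h3] at h2; norm_num at h2
        · rw [h1, h3] at h2; norm_num at h2
      obtain ⟨y, hy, hxy, hyv⟩ := this
      refine ⟨y, hy, hxy, hyv, fun w ε₂ _ _ A hA hvA huA _ hoA hdA => hF0 ⟨A, ?_⟩⟩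
      exact Finset.mem_filter.2 ⟨Finset.mem_powerset.2 hA, hvA, huA, hoA, hdA⟩
  obtain ⟨y, hy, hxy, hyv, hmain⟩ := main
  obtain ⟨w, hw, hwv, ε₂, h₂, c₂⟩ := edge_form (h.ends y hy) hyv
  refine ⟨x, hx, y, hy, hxy, u, w, ε₁, ε₂, h₁, h₂, c₁, c₂, ?_⟩
  have hl := dd_lift en hx hy hxy h₁ h₂ c₁ c₂
  have hm := hmain w ε₂ h₂ c₂
  refine ⟨fun z hz => ?_, h.f01, h.fs, fun z hz => ?_, fun A hA ho => ?_⟩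
  · by_cases hzx : z = x
    · subst hzx; simp [hu, hw]
    · rw [Function.update_of_ne hzx]; exact h.ends z (Finset.mem_of_mem_erase hz)
  · rw [hl]
    have := h.ev z hz
    rcases iv_cases {z} v with a | a <;> rcases iv_cases {z} u with b | b <;>
      rcases iv_cases {z} w with c | c <;> rw [a.2, b.2, c.2] <;> norm_num <;> omega
  · have h1 := h.odd A hA ho
    have h2 := h.evA hA
    rw [hl]
    rcases iv_cases A v with a | a <;> rcases iv_cases A u with b | b <;>
      rcases iv_cases A w with c | c <;> rw [a.2, b.2, c.2] <;> norm_num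
    · linarith
    · linarith
    · linarith
    · have h3 := hm (W \ A) Finset.sdiff_subset (by simp [a.1]) (by simp [hu, b.1])
        (by simp [hw, c.1]) (by
          have := Finset.sum_sdiff (f := f) hA
          have := h.fs
          omega)
      rw [dd_compl hA h.ends] at h3
      omega
    · have h3 := hm A hA a.1 b.1 c.1 ho
      omega
    · linarith
    · linarith
    · linarith

theorem solP_remove {v : V} (h : Ph k W S en f) (hv : v ∈ W) (hf : f v = 0) (hd : dd en S {v} = 0)
    (ih : ∀ S' : Finset E, Ph k (W.erase v) S' en f → SolP k (W.erase v) S' en f) :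
    SolP k W S en f := by
  have hz : ∀ x ∈ S, chi en {v} x = 0 := by
    intro x hx
    have := (Finset.sum_eq_zero_iff_of_nonneg (fun x _ => abs_nonneg (chi en {v} x))).1 hd x hx
    exact abs_eq_zero.1 this
  have hedge : ∀ x ∈ S, x ∉ inn en S (W.erase v) → ∀ A, chi en A x = 0 := by
    intro x hx hn A
    have h1 := h.ends x hx
    have h0 := hz x hx
    unfold chi at h0 ⊢
    rw [iv_single, iv_single] at h0
    have : (en x).1 = v ∧ (en x).2 = v := by
      by_contra hc
      have : (en x).1 ≠ v ∧ (en x).2 ≠ v := by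
        by_cases h2 : (en x).1 = v <;> by_cases h3 : (en x).2 = v <;> simp_all
      exact hn (Finset.mem_filter.2 ⟨hx, Finset.mem_erase.2 ⟨this.1, h1.1⟩,
        Finset.mem_erase.2 ⟨this.2, h1.2⟩⟩)
    rw [this.1, this.2, sub_self]
  have hddeq : ∀ A, dd en (inn en S (W.erase v)) A = dd en S A := by
    intro A
    unfold dd
    refine Finset.sum_subset (Finset.filter_subset _ _) fun x hx hn => ?_
    rw [hedge x hx hn, abs_zero]
  have hsub : W.erase v ⊆ W := Finset.erase_subset _ _
  have hP : Ph k (W.erase v) (inn en S (W.erase v)) en f := by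
    refine ⟨fun x hx => (Finset.mem_filter.1 hx).2, fun z hz => h.f01 z (hsub hz), ?_,
      fun z hz => by rw [hddeq]; exact h.ev z (hsub hz), fun A hA ho => ?_⟩
    · have := h.fs
      rw [← Finset.add_sum_erase W _ hv, hf, zero_add] at this
      exact this
    · rw [hddeq]; exact h.odd A (hA.trans hsub) ho
  obtain ⟨σ, hσ, hs⟩ := ih _ hP
  have hexc : ∀ A, exc en (inn en S (W.erase v)) σ A = exc en S σ A := by
    intro A
    unfold exc
    refine Finset.sum_subset (Finset.filter_subset _ _) fun x hx hn => ?_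
    rw [hedge x hx hn, mul_zero]
  refine ⟨σ, hσ, fun z hzW => ?_⟩
  by_cases hzv : z = v
  · subst hzv
    refine ⟨fun _ => ?_, fun h1 => by omega⟩
    unfold exc
    exact Finset.sum_eq_zero fun x hx => by rw [hz x hx, mul_zero]
  · rw [← hexc]; exact hs z (Finset.mem_erase.2 ⟨hzv, hzW⟩)

theorem solP_core (hk : 2 ≤ k) (hk2 : 2 ∣ k) (h : Ph k W S en f) (hW : W.Nonempty)
    (hf : ∀ v ∈ W, f v = 1) (hd : ∀ v ∈ W, dd en S {v} ≤ 3 * k - 2)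
    (ih : ∀ (W' : Finset V) (en' : E → V × V) (f' : V → ℤ), W'.card < W.card →
      Ph k W' S en' f' → SolP k W' S en' f') : SolP k W S en f := by
  have hk0 : 0 < k := by omega
  set F := W.powerset.filter fun A => A.Nonempty ∧ 2 ∣ ∑ z ∈ A, f z ∧ dd en S A ≤ 2 * k - 2 with hF
  have hWF : W ∈ F := Finset.mem_filter.2 ⟨Finset.mem_powerset_self W, hW, h.fs, by
    rw [dd_W h.ends]; omega⟩
  obtain ⟨X, hX, hmin⟩ := Finset.exists_min_image F Finset.card ⟨W, hWF⟩
  obtain ⟨hXW, hXne, hXe, hXd⟩ := Finset.mem_filter.1 hX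
  rw [Finset.mem_powerset] at hXW
  obtain ⟨a, ha⟩ := hXne
  have hX2 : 2 ≤ X.card := by
    refine card_two_of_ne ha ?_
    rintro rfl
    rw [Finset.sum_singleton, hf a (hXW ha)] at hXe
    norm_num at hXe
  have hc := card_con hXW ha
  have hs : ∀ v ∈ insert a (W \ X), ∀ u ∈ ({v} : Finset V), u ∈ X → u = a := fun v hv =>
    conB (W := W) (Finset.singleton_subset_iff.2 hv)
  have hpar : ∀ B : Finset V, (∀ v ∈ B, v ∈ X → v = a) →
      2 ∣ ∑ v ∈ hat a X B, f v - ∑ v ∈ B, (if v = a then 0 else f v) := by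
    intro B hB
    rw [← sum_hat ha hB, ← Finset.sum_sub_distrib]
    refine Finset.dvd_sum fun v _ => ?_
    unfold conW
    split_ifs
    · simpa using hXe
    · simp
  have hP1 : Ph k (insert a (W \ X)) S (enC a X en) (fun v => if v = a then 0 else f v) := by
    refine ⟨fun x hx => ⟨phi_mem (h.ends x hx).1, phi_mem (h.ends x hx).2⟩, fun v hv => ?_, ?_,
      fun v hv => ?_, fun B hB ho => ?_⟩
    · split_ifs with hva
      · exact Or.inl rfl
      · rcases Finset.mem_insert.1 hv with h1 | h1
        · exact absurd h1 hva
        · exact h.f01 v (Finset.mem_sdiff.1 h1).1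
    · have h1 := hpar _ (conB (W := W) (subset_refl (insert a (W \ X))))
      rw [hat_W hXW ha] at h1
      have := h.fs
      omega
    · rw [dd_hat ha (hs v hv)]
      exact h.evA (hat_subset hXW ha (Finset.singleton_subset_iff.2 hv))
    · rw [dd_hat ha (conB hB)]
      refine h.odd _ (hat_subset hXW ha hB) ?_
      have := hpar B (conB hB)
      omega
  obtain ⟨σ₁, hσ₁, h1⟩ := ih _ _ _ (by omega) hP1
  have hex0 : exc en S σ₁ X = 0 := by
    have := (h1 a (Finset.mem_insert_self _ _)).1 (by simp)
    rwa [exc_hat ha (hs a (Finset.mem_insert_self _ _)), hat_single_a ha] at this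
  have hcutp : ∀ v, 2 ∣ ∑ x ∈ cutE en S X, |chi en {v} x| -
      ∑ x ∈ cutE en S X, σ₁ x * chi en {v} x := fun v => exc_par en (cutE en S X) hσ₁ {v}
  have hI : Inst k X (inn en S X) en
      (fun v => k * f v - ∑ x ∈ cutE en S X, σ₁ x * chi en {v} x)
      (fun v => ∑ x ∈ cutE en S X, |chi en {v} x|)
      (fun v => ∑ x ∈ cutE en S X, σ₁ x * chi en {v} x) ∅ := by
    refine ⟨fun x hx => (Finset.mem_filter.1 hx).2, fun v hv => ?_, ?_, fun v hv => ?_,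
      fun v hv => hcutp v, Set.subsingleton_empty, by simp, ?_, ?_⟩
    · have h2 := dd_split en S (Finset.singleton_subset_iff.2 hv)
      have h3 := h.ev v (hXW hv)
      have h4 := hcutp v
      rw [hf v (hXW hv)]
      omega
    · rw [Finset.sum_sub_distrib, ← exc_cut, hex0, sub_zero, ← Finset.mul_sum, mul_comm 2 k]
      exact mul_dvd_mul_left k hXe
    · exact exc_abs_le en (cutE en S X) hσ₁ {v}
    · intro B hB hBne hBX _
      have e1 : ∑ v ∈ B, (k * f v - ∑ x ∈ cutE en S X, σ₁ x * chi en {v} x +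
          ∑ x ∈ cutE en S X, σ₁ x * chi en {v} x) = k * ∑ v ∈ B, f v := by
        rw [Finset.mul_sum]; exact Finset.sum_congr rfl fun v _ => by ring
      rw [e1, ← cut_abs_sum en S hB, ← dd_split en S hB]
      by_cases ho : 2 ∣ ∑ v ∈ B, f v
      · have e2 : tk k (k * ∑ v ∈ B, f v) = 0 := by
          rw [tk_eq_zero hk0, mul_comm 2 k]; exact mul_dvd_mul_left k ho
        rw [e2, add_zero]
        by_contra hlt
        push Not at hlt
        have := hmin B (Finset.mem_filter.2 ⟨Finset.mem_powerset.2 (hB.trans hXW), hBne, ho, by omega⟩)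
        exact hBX (Finset.eq_of_subset_of_card_le hB this)
      · have h2 := h.odd B (hB.trans hXW) ho
        have h3 := tk_le_k k (k * ∑ v ∈ B, f v)
        linarith
    · rw [← dd_cut]
      have := tk_nonneg hk0 (∑ v ∈ X, ∑ x ∈ cutE en S X, σ₁ x * chi en {v} x)
      linarith
  obtain ⟨σ₂, hσ₂, h2⟩ := stepI hk _ X _ _ _ _ _ _ rfl hI
  obtain ⟨σ, hσ, g1, g2⟩ := exc_glue en S X hσ₁ hσ₂
  refine ⟨σ, hσ, fun v hv => ⟨fun h0 => ?_, fun _ => ?_⟩⟩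
  · rw [hf v hv] at h0; norm_num at h0
  by_cases hvX : v ∈ X
  · have h3 := h2 v hvX
    have h4 := abs_le.1 ((exc_abs_le en S hσ {v}).trans (hd v hv))
    (try dsimp only at h3)
    rw [hf v hv] at h3
    have h5 : 2 * k ∣ exc en S σ {v} - k := by
      rw [g1 v hvX]; convert h3 using 1; ring
    obtain ⟨j, hj⟩ := h5
    have hj1 : j < 1 := by
      by_contra hc
      have : 1 ≤ j := by omega
      nlinarith
    have hj2 : -2 < j := by
      by_contra hc
      have : j ≤ -2 := by omega
      nlinarith
    have : j = 0 ∨ j = -1 := by omega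
    rcases this with rfl | rfl
    · left; linarith
    · right; linarith
  · rw [g2 v hvX]
    have hva : v ≠ a := fun h => hvX (h ▸ ha)
    have hv1 : v ∈ insert a (W \ X) := by simp [hv, hvX]
    have h3 := (h1 v hv1).2 (by dsimp only; rw [if_neg hva, hf v hv])
    rwa [exc_hat ha (hs v hv1), hat_single_ne hva] at h3

theorem phase (hk : 2 ≤ k) (hk2 : 2 ∣ k) (n : ℕ) : ∀ (m : ℕ) (W : Finset V) (S : Finset E)
    (en : E → V × V) (f : V → ℤ), W.card = n → S.card = m → Ph k W S en f → SolP k W S en f := by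
  induction n using Nat.strong_induction_on with
  | _ n ihn =>
  intro m
  induction m using Nat.strong_induction_on with
  | _ m ihm =>
  intro W S en f hn hm h
  have hlift : ∀ v ∈ W, dd en S {v} ≠ 0 → (f v = 1 → 3 * k ≤ dd en S {v}) → SolP k W S en f := by
    intro v hv hd0 hd
    obtain ⟨x, hx, y, hy, hxy, u, w, ε₁, ε₂, h₁, h₂, c₁, c₂, hP⟩ := h.split hk hk2 hv hd0 hd
    obtain ⟨σ, hσ, hs⟩ := ihm _ (by rw [← hm]; exact Finset.card_erase_lt_of_mem hy) W _ _ f hn rfl hP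
    obtain ⟨σ', hσ', h'⟩ := exc_lift en hx hy hxy h₁ h₂ c₁ c₂ hσ
    exact ⟨σ', hσ', fun z hz => by rw [h']; exact hs z hz⟩
  by_cases hW : W.Nonempty
  swap
  · rw [Finset.not_nonempty_iff_eq_empty] at hW
    subst hW
    exact ⟨fun _ => 1, fun _ => Or.inl rfl, by simp⟩
  by_cases h0 : ∃ v ∈ W, f v = 0
  · obtain ⟨v, hv, hf⟩ := h0
    by_cases hd : dd en S {v} = 0
    · exact solP_remove h hv hf hd fun S' hP =>
        ihn _ (by rw [← hn]; exact Finset.card_erase_lt_of_mem hv) _ _ S' en f rfl rfl hP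
    · exact hlift v hv hd (by omega)
  push Not at h0
  have hf : ∀ v ∈ W, f v = 1 := fun v hv => (h.f01 v hv).resolve_left (h0 v hv)
  by_cases h3 : ∃ v ∈ W, 3 * k ≤ dd en S {v}
  · obtain ⟨v, hv, hd⟩ := h3
    exact hlift v hv (by omega) fun _ => hd
  push Not at h3
  refine solP_core hk hk2 h hW hf (fun v hv => ?_) fun W' en' f' hlt hP =>
    ihn _ (by omega) _ W' S en' f' rfl rfl hP
  have h1 := h3 v hv
  have h2 := h.ev v hv
  omega

end phaseOne



/-! ### Splitting an orientation into `k` classes -/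

section split

theorem fib_card {M A : Type*} [DecidableEq M] [DecidableEq A] (α : M → A) (k : ℕ) (S : Finset M)
    (h1 : ∀ x ∈ S, (S.filter fun y => α y = α x).card = k + 1) (s : Finset A)
    (hs : s ⊆ S.image α) : (S.filter fun x => α x ∈ s).card = (k + 1) * s.card := by
  rw [Finset.card_eq_sum_card_fiberwise (f := α) (s := S.filter fun x => α x ∈ s) (t := s)
    (fun x hx => (Finset.mem_filter.1 hx).2), Finset.sum_const_nat (m := k + 1), mul_comm]
  intro a ha
  obtain ⟨x, hx, rfl⟩ := Finset.mem_image.1 (hs ha)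
  rw [← h1 x hx, Finset.filter_filter]
  congr 1
  ext y
  simp only [Finset.mem_filter]
  constructor
  · rintro ⟨p, q, r⟩; exact ⟨p, r⟩
  · rintro ⟨p, r⟩; exact ⟨p, r ▸ ha, r⟩

theorem red_card {M C : Type*} [DecidableEq M] [DecidableEq C] (γ : M → C) (k : ℕ)
    {S T : Finset M} (hTS : T ⊆ S) (x : M) (z : M) (hz : z ∈ T) (hzx : γ z = γ x)
    (hu : ∀ u ∈ T, γ u = γ z → u = z) (hc : (S.filter fun y => γ y = γ x).card = k + 1) :
    ((S \ T).filter fun y => γ y = γ x).card = k := by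
  have : (S \ T).filter (fun y => γ y = γ x) = (S.filter fun y => γ y = γ x).erase z := by
    ext y
    simp only [Finset.mem_filter, Finset.mem_sdiff, Finset.mem_erase]
    constructor
    · rintro ⟨⟨p, q⟩, r⟩
      exact ⟨fun h => q (h ▸ hz), p, r⟩
    · rintro ⟨p, q, r⟩
      exact ⟨⟨q, fun h => p (hu y h (r.trans hzx.symm))⟩, r⟩
  rw [this, Finset.card_erase_of_mem (Finset.mem_filter.2 ⟨hTS hz, hzx⟩), hc]
  rfl

/-- König: a bipartite multigraph, regular of degree `k`, is `k`-edge-colourable. -/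
theorem konig {M A B : Type*} [DecidableEq M] [DecidableEq A] [DecidableEq B]
    (α : M → A) (β : M → B) (k : ℕ) : ∀ S : Finset M,
    (∀ x ∈ S, (S.filter fun y => α y = α x).card = k) →
    (∀ x ∈ S, (S.filter fun y => β y = β x).card = k) →
    ∃ c : M → ℕ, (∀ x ∈ S, c x < k) ∧
      ∀ x ∈ S, ∀ y ∈ S, c x = c y → (α x = α y ∨ β x = β y) → x = y := by
  induction k with
  | zero =>
    intro S h1 _
    have hS : ∀ x, x ∉ S := fun x hx => by
      have h := Finset.card_eq_zero.1 (h1 x hx)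
      have : x ∈ S.filter fun y => α y = α x := by simp [hx]
      rw [h] at this
      simp at this
    exact ⟨fun _ => 0, fun x hx => absurd hx (hS x), fun x hx => absurd hx (hS x)⟩
  | succ k ih =>
    intro S h1 h2
    have cA := fib_card α k S h1
    have cB := fib_card β k S h2
    let t : {a // a ∈ S.image α} → Finset B := fun a => (S.filter fun x => α x = a.1).image β
    have hall := (Finset.all_card_le_biUnion_card_iff_exists_injective t).1 (by
      intro s
      have e1 := cA (s.image Subtype.val) (by
        intro a ha
        obtain ⟨b, _, rfl⟩ := Finset.mem_image.1 ha
        exact b.2)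
      have e2 := cB (s.biUnion t) (by
        intro b hb
        obtain ⟨a, _, hb⟩ := Finset.mem_biUnion.1 hb
        obtain ⟨x, hx, rfl⟩ := Finset.mem_image.1 hb
        exact Finset.mem_image_of_mem _ (Finset.mem_filter.1 hx).1)
      have e3 : (S.filter fun x => α x ∈ s.image Subtype.val).card ≤
          (S.filter fun x => β x ∈ s.biUnion t).card := by
        apply Finset.card_le_card
        intro x hx
        obtain ⟨hx1, hx2⟩ := Finset.mem_filter.1 hx
        obtain ⟨a, ha, hax⟩ := Finset.mem_image.1 hx2
        refine Finset.mem_filter.2 ⟨hx1, Finset.mem_biUnion.2 ⟨a, ha, ?_⟩⟩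
        exact Finset.mem_image_of_mem _ (Finset.mem_filter.2 ⟨hx1, hax.symm⟩)
      rw [e1, e2, Finset.card_image_of_injective _ Subtype.val_injective] at e3
      exact Nat.le_of_mul_le_mul_left e3 (Nat.succ_pos k))
    obtain ⟨g, hg, hgt⟩ := hall
    have hm : ∀ a : {a // a ∈ S.image α}, ∃ x ∈ S, α x = a.1 ∧ β x = g a := by
      intro a
      obtain ⟨x, hx, hx2⟩ := Finset.mem_image.1 (hgt a)
      exact ⟨x, (Finset.mem_filter.1 hx).1, (Finset.mem_filter.1 hx).2, hx2⟩
    choose m hmS hmα hmβ using hm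
    have hsurj : ∀ y ∈ S, ∃ a, g a = β y := by
      have hcard : (S.image β).card ≤ (univ.image g).card := by
        rw [Finset.card_image_of_injective _ hg]
        have e1 := cA _ (subset_refl (S.image α))
        have e2 := cB _ (subset_refl (S.image β))
        rw [Finset.filter_true_of_mem (fun x hx => Finset.mem_image_of_mem _ hx)] at e1 e2
        rw [e1] at e2
        have := Nat.eq_of_mul_eq_mul_left (Nat.succ_pos k) e2
        simp only [Finset.card_univ, Fintype.card_coe]
        omega
      have hsub : univ.image g ⊆ S.image β := by
        intro b hb
        obtain ⟨a, _, rfl⟩ := Finset.mem_image.1 hb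
        rw [← hmβ a]
        exact Finset.mem_image_of_mem _ (hmS a)
      have := Finset.eq_of_subset_of_card_le hsub hcard
      intro y hy
      have h3 : β y ∈ univ.image g := by
        rw [this]; exact Finset.mem_image_of_mem _ hy
      obtain ⟨a, _, ha⟩ := Finset.mem_image.1 h3
      exact ⟨a, ha⟩
    let T : Finset M := univ.image m
    have hTi : ∀ x ∈ T, ∀ y ∈ T, (α x = α y ∨ β x = β y) → x = y := by
      intro x hx y hy h
      obtain ⟨a, _, rfl⟩ := Finset.mem_image.1 hx
      obtain ⟨b, _, rfl⟩ := Finset.mem_image.1 hy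
      rcases h with h | h
      · rw [hmα, hmα] at h
        rw [Subtype.ext h]
      · rw [hmβ, hmβ] at h
        rw [hg h]
    have hTS : T ⊆ S := by
      intro x hx
      obtain ⟨a, _, rfl⟩ := Finset.mem_image.1 hx
      exact hmS a
    obtain ⟨c, hc1, hc2⟩ := ih (S \ T)
      (fun x hx => by
        have hxS := (Finset.mem_sdiff.1 hx).1
        let a : {a // a ∈ S.image α} := ⟨α x, Finset.mem_image_of_mem _ hxS⟩
        exact red_card α k hTS x (m a) (Finset.mem_image_of_mem _ (Finset.mem_univ _)) (hmα a)
          (fun u hu h => hTi u hu _ (Finset.mem_image_of_mem _ (Finset.mem_univ _)) (Or.inl h))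
          (h1 x hxS))
      (fun x hx => by
        have hxS := (Finset.mem_sdiff.1 hx).1
        obtain ⟨a, ha⟩ := hsurj x hxS
        exact red_card β k hTS x (m a) (Finset.mem_image_of_mem _ (Finset.mem_univ _)) ((hmβ a).trans ha)
          (fun u hu h => hTi u hu _ (Finset.mem_image_of_mem _ (Finset.mem_univ _)) (Or.inr h))
          (h2 x hxS))
    refine ⟨fun x => if x ∈ T then k else c x, fun x hx => ?_, fun x hx y hy h h' => ?_⟩
    · dsimp only
      split_ifs with hxT
      · exact Nat.lt_succ_self k
      · exact (hc1 x (Finset.mem_sdiff.2 ⟨hx, hxT⟩)).trans (Nat.lt_succ_self k)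
    · dsimp only at h
      split_ifs at h with hxT hyT hyT
      · exact hTi x hxT y hyT h'
      · have := hc1 y (Finset.mem_sdiff.2 ⟨hy, hyT⟩); omega
      · have := hc1 x (Finset.mem_sdiff.2 ⟨hx, hxT⟩); omega
      · exact hc2 x (Finset.mem_sdiff.2 ⟨hx, hxT⟩) y (Finset.mem_sdiff.2 ⟨hy, hyT⟩) h h'

theorem blocks {M : Type*} [DecidableEq M] (k q : ℕ) : ∀ F L : Finset M, L ⊆ F → L.card ≤ k →
    F.card = k * q → ∃ h : M → ℕ, (∀ x ∈ F, h x < q) ∧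
      (∀ j < q, (F.filter fun x => h x = j).card = k) ∧ ∀ x ∈ L, ∀ y ∈ L, h x = h y := by
  induction q with
  | zero =>
    intro F L hLF _ hF
    have hF0 : F = ∅ := Finset.card_eq_zero.1 (by simpa using hF)
    subst hF0
    refine ⟨fun _ => 0, by simp, by simp, fun _ _ _ _ => rfl⟩
  | succ q ih =>
    intro F L hLF hL hF
    obtain ⟨K, hLK, hKF, hK⟩ := Finset.exists_subsuperset_card_eq hLF hL
      (by rw [hF, Nat.mul_succ]; omega)
    obtain ⟨h, h1, h2, _⟩ := ih (F \ K) ∅ (by simp) (by simp) (by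
      rw [Finset.card_sdiff_of_subset hKF, hF, hK, Nat.mul_succ]; omega)
    refine ⟨fun x => if x ∈ K then q else h x, fun x hx => ?_, fun j hj => ?_, fun x hx y hy => ?_⟩
    · dsimp only
      split_ifs with hxK
      · omega
      · have := h1 x (Finset.mem_sdiff.2 ⟨hx, hxK⟩); omega
    · rcases Nat.lt_succ_iff_lt_or_eq.1 hj with hj | rfl
      · rw [← h2 j hj]
        congr 1
        ext x
        simp only [Finset.mem_filter, Finset.mem_sdiff]
        by_cases hxK : x ∈ K
        · simp [hxK]; omega
        · simp [hxK]
      · rw [← hK]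
        congr 1
        ext x
        simp only [Finset.mem_filter]
        by_cases hxK : x ∈ K
        · simp [hxK, hKF hxK]
        · simp only [hxK, if_false, iff_false, not_and]
          intro hx
          have := h1 x (Finset.mem_sdiff.2 ⟨hx, hxK⟩)
          omega
    · simp [hLK hx, hLK hy]

theorem color_count {M : Type*} [DecidableEq M] (k q : ℕ) (F : Finset M) (h c : M → ℕ)
    (h1 : ∀ x ∈ F, h x < q) (h2 : ∀ j < q, (F.filter fun x => h x = j).card = k)
    (hc : ∀ x ∈ F, c x < k) (hi : ∀ x ∈ F, ∀ y ∈ F, c x = c y → h x = h y → x = y)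
    (i : ℕ) (hik : i < k) : (F.filter fun x => c x = i).card = q := by
  have hinj : Set.InjOn h (F.filter fun x => c x = i : Finset M) := by
    intro x hx y hy hxy
    rw [Finset.mem_coe, Finset.mem_filter] at hx hy
    exact hi x hx.1 y hy.1 (hx.2.trans hy.2.symm) hxy
  rw [← Finset.card_image_of_injOn hinj]
  have : (F.filter fun x => c x = i).image h = Finset.range q := by
    ext j
    simp only [Finset.mem_image, Finset.mem_filter, Finset.mem_range]
    constructor
    · rintro ⟨x, ⟨hx, _⟩, rfl⟩
      exact h1 x hx
    · intro hj
      have hinj2 : Set.InjOn c (F.filter fun x => h x = j : Finset M) := by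
        intro x hx y hy hxy
        rw [Finset.mem_coe, Finset.mem_filter] at hx hy
        exact hi x hx.1 y hy.1 hxy (hx.2.trans hy.2.symm)
      have hsub : (F.filter fun x => h x = j).image c ⊆ Finset.range k := by
        intro a ha
        obtain ⟨x, hx, rfl⟩ := Finset.mem_image.1 ha
        exact Finset.mem_range.2 (hc x (Finset.mem_filter.1 hx).1)
      have heq := Finset.eq_of_subset_of_card_le hsub (by
        rw [Finset.card_image_of_injOn hinj2, h2 j hj, Finset.card_range])
      have hmem : i ∈ (F.filter fun x => h x = j).image c := by
        rw [heq]; exact Finset.mem_range.2 hik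
      obtain ⟨x, hx, hxi⟩ := Finset.mem_image.1 hmem
      exact ⟨x, ⟨(Finset.mem_filter.1 hx).1, hxi⟩, (Finset.mem_filter.1 hx).2⟩
  rw [this, Finset.card_range]

theorem split_classes [Fintype V] [Fintype E] [DecidableEq V] [DecidableEq E] (k : ℕ)
    (o p : E → V) (L qo qp : V → ℕ) (hL : ∀ v, L v ≤ k)
    (ho : ∀ v, (univ.filter fun e => o e = v).card + L v = k * qo v)
    (hp : ∀ v, (univ.filter fun e => p e = v).card + L v = k * qp v) :
    ∃ c : E → ℕ, (∀ e, c e < k) ∧ ∀ v, ∀ i < k, ∃ l ≤ 1, l ≤ L v ∧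
      (univ.filter fun e => o e = v ∧ c e = i).card + l = qo v ∧
      (univ.filter fun e => p e = v ∧ c e = i).card + l = qp v := by
  let M := E ⊕ (Σ v : V, Fin (L v))
  let o' : M → V := Sum.elim o (fun x => x.1)
  let p' : M → V := Sum.elim p (fun x => x.1)
  let Lp : V → Finset M := fun v => (univ.filter fun y : (Σ v : V, Fin (L v)) => y.1 = v).map
    Function.Embedding.inr
  have split_card : ∀ (P : M → Prop) [DecidablePred P], (univ.filter P).card =
      (univ.filter fun e : E => P (Sum.inl e)).card +
      (univ.filter fun y : (Σ v : V, Fin (L v)) => P (Sum.inr y)).card := by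
    intro P _
    rw [Finset.card_filter, Fintype.sum_sum_type, ← Finset.card_filter, ← Finset.card_filter]
  have cardS : ∀ v, (univ.filter fun y : (Σ v : V, Fin (L v)) => y.1 = v).card = L v := by
    intro v
    rw [Finset.card_filter, Fintype.sum_sigma, Finset.sum_eq_single v]
    · simp
    · intro u _ hu; simp [hu]
    · simp
  have cardL : ∀ v, (Lp v).card = L v := by
    intro v
    simp only [Lp]
    rw [Finset.card_map, cardS]
  have cardo : ∀ v, (univ.filter fun x => o' x = v).card = k * qo v := by
    intro v
    rw [split_card, ← ho v]
    exact congrArg (_ + ·) (cardS v)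
  have cardp : ∀ v, (univ.filter fun x => p' x = v).card = k * qp v := by
    intro v
    rw [split_card, ← hp v]
    exact congrArg (_ + ·) (cardS v)
  have memL : ∀ v (x : Σ v : V, Fin (L v)), x.1 = v → (Sum.inr x : M) ∈ Lp v := by
    intro v x hx
    exact Finset.mem_map.2 ⟨x, Finset.mem_filter.2 ⟨Finset.mem_univ _, hx⟩, rfl⟩
  have Lo : ∀ v, Lp v ⊆ univ.filter fun x => o' x = v := by
    intro v x hx
    obtain ⟨y, hy, rfl⟩ := Finset.mem_map.1 hx
    exact Finset.mem_filter.2 ⟨Finset.mem_univ _, (Finset.mem_filter.1 hy).2⟩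
  have Lpp : ∀ v, Lp v ⊆ univ.filter fun x => p' x = v := by
    intro v x hx
    obtain ⟨y, hy, rfl⟩ := Finset.mem_map.1 hx
    exact Finset.mem_filter.2 ⟨Finset.mem_univ _, (Finset.mem_filter.1 hy).2⟩
  choose a a1 a2 a3 using fun v => blocks k (qo v) _ _ (Lo v) ((cardL v).trans_le (hL v)) (cardo v)
  choose b b1 b2 _ using fun v => blocks k (qp v) _ _ (Lpp v) ((cardL v).trans_le (hL v)) (cardp v)
  obtain ⟨c, hc1, hc2⟩ := konig (fun x => (o' x, a (o' x) x)) (fun x => (p' x, b (p' x) x)) k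
    univ (by
      intro x _
      rw [← a2 (o' x) (a (o' x) x) (a1 _ x (by simp)), Finset.filter_filter]
      congr 1
      ext y
      simp only [Finset.mem_filter, Finset.mem_univ, true_and, Prod.mk.injEq]
      constructor
      · rintro ⟨h, h'⟩; rw [h] at h'; exact ⟨h, h'⟩
      · rintro ⟨h, h'⟩; refine ⟨h, ?_⟩; rw [h]; exact h') (by
      intro x _
      rw [← b2 (p' x) (b (p' x) x) (b1 _ x (by simp)), Finset.filter_filter]
      congr 1
      ext y
      simp only [Finset.mem_filter, Finset.mem_univ, true_and, Prod.mk.injEq]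
      constructor
      · rintro ⟨h, h'⟩; rw [h] at h'; exact ⟨h, h'⟩
      · rintro ⟨h, h'⟩; refine ⟨h, ?_⟩; rw [h]; exact h')
  refine ⟨fun e => c (Sum.inl e), fun e => hc1 _ (Finset.mem_univ _), fun v i hi => ?_⟩
  have co := color_count k (qo v) (univ.filter fun x => o' x = v) (a v) c (a1 v) (a2 v)
    (fun x _ => hc1 x (Finset.mem_univ _)) (by
      intro x hx y hy h h'
      refine hc2 x (Finset.mem_univ _) y (Finset.mem_univ _) h (Or.inl ?_)
      have hx := (Finset.mem_filter.1 hx).2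
      have hy := (Finset.mem_filter.1 hy).2
      simp only [hx, hy, h']) i hi
  have cp := color_count k (qp v) (univ.filter fun x => p' x = v) (b v) c (b1 v) (b2 v)
    (fun x _ => hc1 x (Finset.mem_univ _)) (by
      intro x hx y hy h h'
      refine hc2 x (Finset.mem_univ _) y (Finset.mem_univ _) h (Or.inr ?_)
      have hx := (Finset.mem_filter.1 hx).2
      have hy := (Finset.mem_filter.1 hy).2
      simp only [hx, hy, h']) i hi
  rw [Finset.filter_filter, split_card] at co cp
  refine ⟨(univ.filter fun y : (Σ v : V, Fin (L v)) => y.1 = v ∧ c (Sum.inr y) = i).card,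
    ?_, ?_, co, cp⟩
  · rw [Finset.card_le_one]
    intro x hx y hy
    obtain ⟨hx1, hx2⟩ := (Finset.mem_filter.1 hx).2
    obtain ⟨hy1, hy2⟩ := (Finset.mem_filter.1 hy).2
    have key := hc2 (Sum.inr x) (Finset.mem_univ _) (Sum.inr y) (Finset.mem_univ _)
      (hx2.trans hy2.symm) (Or.inl (by
        have e := a3 v (Sum.inr x) (memL v x hx1) (Sum.inr y) (memL v y hy1)
        simp only [o', Sum.elim_inr, hx1, hy1, e]))
    exact Sum.inr_injective key
  · rw [← cardS v]
    apply Finset.card_le_card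
    intro x hx
    exact Finset.mem_filter.2 ⟨Finset.mem_univ _, (Finset.mem_filter.1 hx).2.1⟩

end split



/-! ### Translation to the statement -/

section final
variable [DecidableEq V] [DecidableEq E]

theorem mdeg_sum (en : E → V × V) (S : Finset E) (v : V) :
    (mdeg en S v : ℤ) = ∑ e ∈ S, (iv {v} (en e).1 + iv {v} (en e).2) := by
  unfold mdeg
  rw [Finset.sum_add_distrib, Finset.card_filter, Finset.card_filter]
  push_cast
  simp only [iv_single]

theorem cutCard_eq [Fintype E] (en : E → V × V) (X : Finset V) :
    (cutCard en X : ℤ) = dd en univ X := by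
  unfold cutCard dd
  rw [Finset.card_filter]
  push_cast
  refine Finset.sum_congr rfl fun e _ => ?_
  unfold chi iv
  by_cases h1 : (en e).1 ∈ X <;> by_cases h2 : (en e).2 ∈ X <;> simp [h1, h2]

theorem dd_mdeg (en : E → V × V) (S : Finset E) (v : V) :
    2 ∣ (mdeg en S v : ℤ) - dd en S {v} := by
  rw [mdeg_sum]
  unfold dd
  rw [← Finset.sum_sub_distrib]
  refine Finset.dvd_sum fun e _ => ?_
  unfold chi
  rcases iv_cases {v} (en e).1 with h | h <;> rcases iv_cases {v} (en e).2 with h' | h' <;>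
    simp [h.2, h'.2]

/-- Tail of an edge. -/
def tl (en : E → V × V) (σ : E → ℤ) (e : E) : V := if σ e = 1 then (en e).1 else (en e).2
/-- Head of an edge. -/
def hd (en : E → V × V) (σ : E → ℤ) (e : E) : V := if σ e = 1 then (en e).2 else (en e).1

theorem mdeg_tl_hd (en : E → V × V) (σ : E → ℤ) (S : Finset E) (v : V) :
    mdeg en S v = (S.filter fun e => tl en σ e = v).card + (S.filter fun e => hd en σ e = v).card := by
  unfold mdeg
  simp only [Finset.card_filter]
  rw [← Finset.sum_add_distrib, ← Finset.sum_add_distrib]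
  refine Finset.sum_congr rfl fun e _ => ?_
  unfold tl hd
  by_cases h : σ e = 1
  · simp only [if_pos h]
  · simp only [if_neg h]; rw [add_comm]

theorem exc_tl_hd (en : E → V × V) {σ : E → ℤ} (hσ : PM σ) (S : Finset E) (v : V) :
    exc en S σ {v} =
      (S.filter fun e => tl en σ e = v).card - (S.filter fun e => hd en σ e = v).card := by
  unfold exc
  simp only [Finset.card_filter]
  push_cast
  rw [← Finset.sum_sub_distrib]
  refine Finset.sum_congr rfl fun e _ => ?_
  unfold tl hd chi
  simp only [iv_single]
  rcases hσ e with h | h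
  · simp [h]
  · have h' : σ e ≠ 1 := by rw [h]; decide
    simp only [if_neg h']
    rw [h]; ring

theorem val_sum (f : V → ZMod 2) (X : Finset V) :
    (2 : ℤ) ∣ ∑ v ∈ X, ((f v).val : ℤ) ↔ ∑ v ∈ X, f v = 0 := by
  have h := ZMod.intCast_zmod_eq_zero_iff_dvd (∑ v ∈ X, ((f v).val : ℤ)) 2
  rw [show ((2 : ℕ) : ℤ) = 2 from rfl] at h
  rw [← h]
  push_cast
  simp

theorem main_aux [Fintype V] [Fintype E]
    (ends : E → V × V) (k : ℕ) (hk : Even k) (hk0 : 0 < k)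
    (heven : ∀ v : V, Even (mdeg ends univ v))
    (f : V → ZMod 2) (hf : ∑ v : V, f v = 0)
    (hconn : ∀ X : Finset V, ∑ v ∈ X, f v ≠ 0 → 3 * k - 2 ≤ cutCard ends X) :
    ∃ c : E → Fin k, ∀ v : V, ∀ i : Fin k,
      ((mdeg ends (univ.filter fun e => c e = i) v : ZMod 2) = f v) ∧
      |((mdeg ends (univ.filter fun e => c e = i) v : ℝ)) -
        (mdeg ends univ v : ℝ) / (k : ℝ)| < 2 := by
  have h2k : (2 : ℤ) ∣ k := by obtain ⟨r, hr⟩ := hk; exact ⟨r, by omega⟩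
  have hk2 : (2 : ℤ) ≤ k := by obtain ⟨r, hr⟩ := hk; omega
  have h01 : ∀ v, ((f v).val = 0 ∨ (f v).val = 1) := fun v => by
    have := ZMod.val_lt (f v); omega
  have hPh : Ph (k : ℤ) (univ : Finset V) (univ : Finset E) ends (fun v => ((f v).val : ℤ)) := by
    refine ⟨fun x _ => ⟨mem_univ _, mem_univ _⟩, fun v _ => ?_, (val_sum f univ).2 hf,
      fun v _ => ?_, fun A _ hA => ?_⟩
    · have := h01 v; omega
    · have h1 := dd_mdeg ends univ v
      obtain ⟨r, hr⟩ := heven v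
      omega
    · rw [← cutCard_eq]
      have := hconn A (fun h => hA ((val_sum f A).2 h))
      omega
  obtain ⟨σ, hσ, hs⟩ := phase hk2 h2k _ _ _ _ _ _ rfl rfl hPh
  set o := fun v => (univ.filter fun e => tl ends σ e = v).card with ho
  set p := fun v => (univ.filter fun e => hd ends σ e = v).card with hp
  have hex : ∀ v, ∃ L qo qp : ℕ, L < k ∧ o v + L = k * qo ∧ p v + L = k * qp ∧
      (((qo + qp : ℕ) : ZMod 2) = f v) := by
    intro v
    obtain ⟨hs0, hs1⟩ := hs v (mem_univ v)
    rw [exc_tl_hd ends hσ] at hs0 hs1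
    change ((f v).val : ℤ) = 0 → (o v : ℤ) - p v = 0 at hs0
    change ((f v).val : ℤ) = 1 → (o v : ℤ) - p v = k ∨ (o v : ℤ) - p v = -k at hs1
    have hfv : f v = (((f v).val : ℕ) : ZMod 2) := (ZMod.natCast_zmod_val (f v)).symm
    have hL : ∀ m : ℕ, ∃ L q : ℕ, L < k ∧ m + L = k * q := by
      intro m
      have e1 := Nat.div_add_mod m k
      have e2 := Nat.mod_lt m hk0
      by_cases h0 : m % k = 0
      · exact ⟨0, m / k, hk0, by omega⟩
      · exact ⟨k - m % k, m / k + 1, by omega, by rw [Nat.mul_succ]; omega⟩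
    have two0 : ((2 : ℕ) : ZMod 2) = 0 := by decide
    rcases h01 v with h | h
    · obtain ⟨L, q, hLk, hq⟩ := hL (o v)
      have e := hs0 (by omega)
      refine ⟨L, q, q, hLk, hq, by omega, ?_⟩
      rw [hfv, h, ← two_mul, Nat.cast_mul, two0]; simp
    · rcases hs1 (by omega) with e | e
      · obtain ⟨L, q, hLk, hq⟩ := hL (p v)
        refine ⟨L, q + 1, q, hLk, by rw [Nat.mul_succ]; omega, hq, ?_⟩
        rw [hfv, h, show q + 1 + q = 2 * q + 1 by ring, Nat.cast_add, Nat.cast_mul, two0]; simp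
      · obtain ⟨L, q, hLk, hq⟩ := hL (o v)
        refine ⟨L, q, q + 1, hLk, hq, by rw [Nat.mul_succ]; omega, ?_⟩
        rw [hfv, h, show q + (q + 1) = 2 * q + 1 by ring, Nat.cast_add, Nat.cast_mul, two0]; simp
  choose L qo qp hLk hqo hqp hpar using hex
  obtain ⟨c, hc, hcl⟩ := split_classes k (tl ends σ) (hd ends σ) L qo qp (fun v => (hLk v).le)
    hqo hqp
  refine ⟨fun e => ⟨c e, hc e⟩, fun v i => ?_⟩
  obtain ⟨l, hl1, hlL, e1, e2⟩ := hcl v i.1 i.2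
  have hm : mdeg ends (univ.filter fun e => (⟨c e, hc e⟩ : Fin k) = i) v + 2 * l
      = qo v + qp v := by
    rw [mdeg_tl_hd ends σ, Finset.filter_filter, Finset.filter_filter, ← e1, ← e2]
    have r1 : ∀ g : E → V, (univ.filter fun e => (⟨c e, hc e⟩ : Fin k) = i ∧ g e = v) =
        univ.filter fun e => g e = v ∧ c e = i.1 := by
      intro g
      ext e
      simp only [mem_filter, mem_univ, true_and, Fin.ext_iff]
      exact and_comm
    rw [r1, r1]
    ring
  have hd' : mdeg ends univ v + 2 * L v = k * (qo v + qp v) := by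
    rw [mdeg_tl_hd ends σ, mul_add, ← hqo v, ← hqp v]
    simp only [ho, hp]
    ring
  constructor
  · rw [← hpar v, ← hm, Nat.cast_add, Nat.cast_mul]
    have two0 : ((2 : ℕ) : ZMod 2) = 0 := by decide
    rw [two0]; simp
  · have hkR : (0 : ℝ) < k := by exact_mod_cast hk0
    have hmR : (mdeg ends (univ.filter fun e => (⟨c e, hc e⟩ : Fin k) = i) v : ℝ) + 2 * l
      = qo v + qp v := by exact_mod_cast hm
    have hdR : (mdeg ends univ v : ℝ) + 2 * L v = k * (qo v + qp v) := by exact_mod_cast hd'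
    have hLR : (L v : ℝ) < k := by exact_mod_cast hLk v
    have hL0 : (0 : ℝ) ≤ L v := Nat.cast_nonneg _
    have key : (mdeg ends (univ.filter fun e => (⟨c e, hc e⟩ : Fin k) = i) v : ℝ) -
        (mdeg ends univ v : ℝ) / k = 2 * (L v / k - l) := by
      have a1 : (mdeg ends univ v : ℝ) = k * (qo v + qp v) - 2 * L v := by linarith
      have a2 : (mdeg ends (univ.filter fun e => (⟨c e, hc e⟩ : Fin k) = i) v : ℝ) =
        qo v + qp v - 2 * l := by linarith
      rw [a1, a2]
      field_simp
      ring
    rw [key]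
    have b1 : (L v : ℝ) / k < 1 := (div_lt_one hkR).2 hLR
    have b0 : 0 ≤ (L v : ℝ) / k := div_nonneg hL0 hkR.le
    rcases Nat.le_one_iff_eq_zero_or_eq_one.1 hl1 with rfl | rfl
    · rw [abs_lt]; constructor <;> push_cast <;> linarith
    · have b2 : 0 < (L v : ℝ) / k := div_pos (by exact_mod_cast hlL) hkR
      rw [abs_lt]; constructor <;> push_cast <;> linarith

end final


end PF

/-- Parity factorization of Eulerian multigraphs for even `k`, with prescribed parities
`f` summing to zero in `Z_2`. -/
theorem parity_factorization_even_k [Fintype V] [Fintype E] [DecidableEq V]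
    (ends : E → V × V) (k : ℕ) (hk : Even k) (hk0 : 0 < k)
    (heven : ∀ v : V, Even (mdeg ends univ v))
    (f : V → ZMod 2) (hf : ∑ v : V, f v = 0)
    (hconn : ∀ X : Finset V, ∑ v ∈ X, f v ≠ 0 → 3 * k - 2 ≤ cutCard ends X) :
    ∃ c : E → Fin k, ∀ v : V, ∀ i : Fin k,
      ((mdeg ends (univ.filter fun e => c e = i) v : ZMod 2) = f v) ∧
      |((mdeg ends (univ.filter fun e => c e = i) v : ℝ)) -
        (mdeg ends univ v : ℝ) / (k : ℝ)| < 2 := by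
  classical
  exact PF.main_aux ends k hk hk0 heven f hf hconn
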